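/- For every τ in the upper half-plane ℍ, one has the identity of Eisenstein series 9·E₄(3τ) − E₄(τ) = 8·E₁(τ)·(2E₃(τ) − E₁(τ)³). -/

import Mathlib

noncomputable section

/-- The quadratic character mod 3 (Legendre symbol `(d/3)`). -/
def chi3 (d : ℕ) : ℤ := if d % 3 = 1 then 1 else if d % 3 = 2 then -1 else 0

/-- The weight-one Eisenstein series for `Γ₁(3)`:
`E₁(τ) = 1 + 6·Σ_{n≥1} (Σ_{d ∣ n} χ(d)) qⁿ` with `q = exp(2πiτ)`. -/
def E1 (τ : ℂ) : ℂ :=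
  1 + 6 * ∑' n : ℕ, (∑ d ∈ n.divisors, (chi3 d : ℂ)) *
    Complex.exp (2 * Real.pi * Complex.I * τ) ^ n

/-- The weight-three Eisenstein series for `Γ₁(3)`:
`E₃(τ) = 1 − 9·Σ_{n≥1} (Σ_{d ∣ n} χ(d)d²) qⁿ`. -/
def E3 (τ : ℂ) : ℂ :=
  1 - 9 * ∑' n : ℕ, (∑ d ∈ n.divisors, (chi3 d : ℂ) * (d : ℂ) ^ 2) *
    Complex.exp (2 * Real.pi * Complex.I * τ) ^ n

/-- The weight-four Eisenstein series for `SL(2,ℤ)`: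
`E₄(τ) = 1 + 240·Σ_{n≥1} (Σ_{d ∣ n} d³) qⁿ`. -/
def E4 (τ : ℂ) : ℂ :=
  1 + 240 * ∑' n : ℕ, (∑ d ∈ n.divisors, (d : ℂ) ^ 3) *
    Complex.exp (2 * Real.pi * Complex.I * τ) ^ n

/-- The two-sided series `∑ n ∈ ℤ, n ^ j * f n * x ^ n`. -/
def bilateral (f : ℤ → ℂ) (j : ℕ) (x : ℂ) : ℂ := ∑' n : ℤ, (n : ℂ) ^ j * f n * x ^ n

/-- The coefficients `1 / (1 - q ^ n)`, with value `0` at `n = 0`. -/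
def lambertCoeff (q : ℂ) (n : ℤ) : ℂ := (1 - q ^ n)⁻¹

/-- The indicator function of the positive integers. -/
def posInd (n : ℤ) : ℂ := if 0 < n then 1 else 0

/-- The exponentially decaying part of `lambertCoeff`. -/
def lambertTail (q : ℂ) (n : ℤ) : ℂ := lambertCoeff q n - posInd n

/-- The exponentially decaying part of the square of `lambertCoeff`. -/
def lambertSqTail (q : ℂ) (n : ℤ) : ℂ := lambertCoeff q n ^ 2 - posInd n

lemma summable_natAbs_pow_mul_geometric (j : ℕ) {s : ℝ} (hs0 : 0 ≤ s) (hs : s < 1) :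
    Summable fun n : ℤ => (n.natAbs : ℝ) ^ j * s ^ n.natAbs := by
  have h := summable_pow_mul_geometric_of_norm_lt_one (R := ℝ) j (r := s)
    (by rwa [Real.norm_of_nonneg hs0])
  exact Summable.of_nat_of_neg (by simpa using h) (by simpa using h)

lemma norm_intCast_eq_natAbs (n : ℤ) : ‖(n : ℂ)‖ = n.natAbs := by
  rw [Complex.norm_intCast, Nat.cast_natAbs, Int.cast_abs]

section Basic

variable {q : ℂ}

lemma zpow_ne_one_of_norm_lt_one (hq : ‖q‖ < 1) {n : ℤ} (hn : n ≠ 0) :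
    q ^ n ≠ 1 := by
  intro h
  have h1 : ‖q‖ ^ n = 1 := by rw [← norm_zpow, h, norm_one]
  exact hn ((zpow_eq_one_iff_right₀ (norm_nonneg q) hq.ne).1 h1)

lemma lambertCoeff_zero : lambertCoeff q 0 = 0 := by simp [lambertCoeff]

lemma lambertCoeff_neg (hq0 : q ≠ 0) (hq : ‖q‖ < 1) {n : ℤ} (hn : n ≠ 0) :
    lambertCoeff q (-n) = 1 - lambertCoeff q n := by
  have h1 := sub_ne_zero.2 (zpow_ne_one_of_norm_lt_one hq hn).symm
  have h2 := sub_ne_zero.2 (zpow_ne_one_of_norm_lt_one hq (neg_ne_zero.2 hn)).symm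
  have h3 : q ^ n ≠ 0 := zpow_ne_zero _ hq0
  simp only [lambertCoeff]
  rw [zpow_neg] at *
  field_simp at *
  have h4 : q ^ n - 1 ≠ 0 := fun h => h1 (by linear_combination -h)
  field_simp
  ring

lemma lambertCoeff_mul (hq0 : q ≠ 0) (hq : ‖q‖ < 1) {n m : ℤ} (hn : n ≠ 0) (hm : m ≠ 0)
    (hnm : n + m ≠ 0) :
    lambertCoeff q n * lambertCoeff q m =
      lambertCoeff q (n + m) * (lambertCoeff q n + lambertCoeff q m - 1) := by
  have h1 := sub_ne_zero.2 (zpow_ne_one_of_norm_lt_one hq hn).symm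
  have h2 := sub_ne_zero.2 (zpow_ne_one_of_norm_lt_one hq hm).symm
  have h3 := sub_ne_zero.2 (zpow_ne_one_of_norm_lt_one hq hnm).symm
  simp only [lambertCoeff]
  rw [zpow_add₀ hq0] at *
  field_simp
  ring

lemma lambertTail_zero : lambertTail q 0 = 0 := by simp [lambertTail, lambertCoeff_zero, posInd]

lemma lambertTail_neg (hq0 : q ≠ 0) (hq : ‖q‖ < 1) (n : ℤ) :
    lambertTail q (-n) = -lambertTail q n := by
  rcases eq_or_ne n 0 with rfl | hn
  · simp [lambertTail_zero]
  · rw [lambertTail, lambertTail, lambertCoeff_neg hq0 hq hn]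
    rcases lt_or_gt_of_ne hn with h | h
    · simp [posInd, h, not_lt.2 h.le]
    · simp [posInd, h, not_lt.2 h.le]

lemma lambertSqTail_neg (hq0 : q ≠ 0) (hq : ‖q‖ < 1) (n : ℤ) :
    lambertSqTail q (-n) = lambertSqTail q n - 2 * lambertTail q n := by
  rcases eq_or_ne n 0 with rfl | hn
  · simp [lambertTail_zero]
  · rw [lambertTail, lambertSqTail, lambertSqTail, lambertCoeff_neg hq0 hq hn]
    rcases lt_or_gt_of_ne hn with h | h
    · simp [posInd, h, not_lt.2 h.le]; ring
    · simp [posInd, h, not_lt.2 h.le]; ring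

lemma lambertTail_natCast (hq : ‖q‖ < 1) (n : ℕ) :
    lambertTail q n = q ^ n / (1 - q ^ n) := by
  rcases Nat.eq_zero_or_pos n with rfl | hn
  · simp [lambertTail_zero]
  · have h1 := sub_ne_zero.2 (zpow_ne_one_of_norm_lt_one hq (n := n) (by omega)).symm
    simp only [lambertTail, lambertCoeff, posInd, zpow_natCast] at *
    rw [if_pos (by exact_mod_cast hn)]
    field_simp
    ring

lemma norm_lambertTail_le (hq0 : q ≠ 0) (hq : ‖q‖ < 1) (n : ℤ) :
    ‖lambertTail q n‖ ≤ (1 - ‖q‖)⁻¹ * ‖q‖ ^ n.natAbs := by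
  have key (n : ℕ) : ‖lambertTail q n‖ ≤ (1 - ‖q‖)⁻¹ * ‖q‖ ^ n := by
    have hpos : 0 < 1 - ‖q‖ := by linarith
    rcases Nat.eq_zero_or_pos n with rfl | hn
    · simpa [lambertTail_zero] using hpos.le
    · rw [lambertTail_natCast hq, norm_div, norm_pow, div_eq_inv_mul]
      gcongr
      calc 1 - ‖q‖ ≤ 1 - ‖q‖ ^ n := by
            have := pow_le_of_le_one (norm_nonneg q) hq.le hn.ne'
            linarith
        _ = ‖(1 : ℂ)‖ - ‖q ^ n‖ := by simp
        _ ≤ _ := norm_sub_norm_le _ _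
  rcases Int.natAbs_eq n with h | h
  · rw [h, Int.natAbs_natCast]; exact key n.natAbs
  · rw [h, lambertTail_neg hq0 hq, norm_neg, Int.natAbs_neg, Int.natAbs_natCast]
    exact key n.natAbs

lemma exists_norm_lambertSqTail_le (hq0 : q ≠ 0) (hq : ‖q‖ < 1) :
    ∃ M, ∀ n, ‖lambertSqTail q n‖ ≤ M * ‖q‖ ^ n.natAbs := by
  set K := (1 - ‖q‖)⁻¹
  have hK : 0 ≤ K := inv_nonneg.2 (by linarith)
  refine ⟨(K + 2) * K, fun n => ?_⟩
  have h0 := norm_lambertTail_le hq0 hq n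
  have hq1 : ‖q‖ ^ n.natAbs ≤ 1 := pow_le_one₀ (norm_nonneg q) hq.le
  have h1 : lambertSqTail q n = (lambertTail q n + 2 * posInd n) * lambertTail q n := by
    simp only [lambertSqTail, lambertTail, posInd]
    split_ifs <;> ring
  have h2 : ‖(posInd n)‖ ≤ 1 := by simp only [posInd]; split_ifs <;> simp
  rw [h1, norm_mul, mul_assoc]
  refine mul_le_mul ?_ h0 (norm_nonneg _) (by linarith)
  refine (norm_add_le _ _).trans ?_
  rw [norm_mul, Complex.norm_ofNat]
  have : K * ‖q‖ ^ n.natAbs ≤ K := mul_le_of_le_one_right hK hq1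
  linarith

end Basic

section Bilateral

variable {q : ℂ} {f : ℤ → ℂ} {M : ℝ}

lemma norm_bilateral_term_le (hf : ∀ n, ‖f n‖ ≤ M * ‖q‖ ^ n.natAbs) {ρ : ℝ} (hρ : 0 < ρ)
    (j : ℕ) {x : ℂ} (hx : ρ ≤ ‖x‖) (hx1 : ‖x‖ ≤ 1) (n : ℤ) :
    ‖(n : ℂ) ^ j * f n * x ^ n‖ ≤ M * ((n.natAbs : ℝ) ^ j * (‖q‖ / ρ) ^ n.natAbs) := by
  have hx0 : 0 < ‖x‖ := hρ.trans_le hx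
  have h1 : ‖x ^ n‖ ≤ (ρ⁻¹) ^ n.natAbs := by
    rw [norm_zpow]
    rcases Int.natAbs_eq n with h | h
    · rw [h]
      simp only [zpow_natCast, Int.natAbs_natCast]
      exact (pow_le_one₀ hx0.le hx1).trans
        (one_le_pow₀ ((one_le_inv₀ hρ).2 (hx.trans hx1)))
    · rw [h]
      simp only [zpow_neg, zpow_natCast, Int.natAbs_neg, Int.natAbs_natCast]
      rw [← inv_pow]
      gcongr
  rw [norm_mul, norm_mul, norm_pow, norm_intCast_eq_natAbs]
  calc _ ≤ (n.natAbs : ℝ) ^ j * (M * ‖q‖ ^ n.natAbs) * (ρ⁻¹) ^ n.natAbs := by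
        gcongr
        · exact mul_nonneg (by positivity) ((norm_nonneg _).trans (hf n))
        · exact hf n
    _ = _ := by rw [div_eq_mul_inv, mul_pow]; ring

lemma summable_norm_bilateral (hf : ∀ n, ‖f n‖ ≤ M * ‖q‖ ^ n.natAbs) (j : ℕ) {x : ℂ}
    (hx : ‖q‖ < ‖x‖) (hx1 : ‖x‖ ≤ 1) :
    Summable fun n : ℤ => ‖(n : ℂ) ^ j * f n * x ^ n‖ := by
  have hx0 : 0 < ‖x‖ := (norm_nonneg q).trans_lt hx
  exact Summable.of_nonneg_of_le (fun _ => norm_nonneg _)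
    (norm_bilateral_term_le hf hx0 j le_rfl hx1)
    ((summable_natAbs_pow_mul_geometric j (by positivity) ((div_lt_one hx0).2 hx)).mul_left M)

lemma continuousOn_bilateral (hf : ∀ n, ‖f n‖ ≤ M * ‖q‖ ^ n.natAbs) (j : ℕ) {ρ : ℝ}
    (hρ : ‖q‖ < ρ) :
    ContinuousOn (bilateral f j) {x | ρ ≤ ‖x‖ ∧ ‖x‖ ≤ 1} := by
  have hρ0 : 0 < ρ := (norm_nonneg q).trans_lt hρ
  refine continuousOn_tsum (fun n => ?_)
    ((summable_natAbs_pow_mul_geometric j (by positivity) ((div_lt_one hρ0).2 hρ)).mul_left M)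
    (fun n x hx => norm_bilateral_term_le hf hρ0 j hx.1 hx.2 n)
  refine continuousOn_const.mul fun x hx => ?_
  exact (continuousAt_zpow₀ x n
    (Or.inl (norm_pos_iff.1 (hρ0.trans_le hx.1)))).continuousWithinAt

lemma summable_norm_bilateral_posInd (j : ℕ) {x : ℂ} (hx1 : ‖x‖ < 1) :
    Summable fun n : ℤ => ‖(n : ℂ) ^ j * posInd n * x ^ n‖ := by
  refine Summable.of_nonneg_of_le (fun _ => norm_nonneg _) (fun n => ?_)
    (summable_natAbs_pow_mul_geometric j (norm_nonneg x) hx1)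
  simp only [posInd]
  split_ifs with h
  · rw [mul_one, norm_mul, norm_pow, norm_intCast_eq_natAbs, norm_zpow]
    obtain ⟨k, rfl⟩ := Int.eq_ofNat_of_zero_le h.le
    simp
  · simp only [mul_zero, zero_mul, norm_zero]
    positivity

lemma bilateral_neg_arg (f : ℤ → ℂ) (j : ℕ) (x : ℂ) :
    bilateral f j x⁻¹ = (-1) ^ j * bilateral (fun n => f (-n)) j x := by
  rw [bilateral, bilateral, ← tsum_mul_left, ← (Equiv.neg ℤ).tsum_eq]
  refine tsum_congr fun n => ?_
  simp only [Equiv.neg_apply, Int.cast_neg, inv_zpow', neg_neg]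
  rw [neg_pow]
  ring

lemma bilateral_add {f g : ℤ → ℂ} {j : ℕ} {x : ℂ}
    (hf : Summable fun n : ℤ => (n : ℂ) ^ j * f n * x ^ n)
    (hg : Summable fun n : ℤ => (n : ℂ) ^ j * g n * x ^ n) :
    bilateral (fun n => f n + g n) j x = bilateral f j x + bilateral g j x := by
  rw [bilateral, bilateral, bilateral, ← hf.tsum_add hg]
  exact tsum_congr fun n => by ring

end Bilateral

section PosInd

variable {x : ℂ}

lemma bilateral_posInd_eq (j : ℕ) (x : ℂ) :
    bilateral posInd j x = ∑' n : ℕ, ((n : ℂ) + 1) ^ j * x ^ (n + 1) := by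
  have hi : Function.Injective fun n : ℕ => (n : ℤ) + 1 := fun a b h => by simpa using h
  rw [bilateral, ← hi.tsum_eq]
  · refine tsum_congr fun n => ?_
    have h1 : (0 : ℤ) < n + 1 := by omega
    have h2 : x ^ ((n : ℤ) + 1) = x ^ (n + 1) := by exact_mod_cast zpow_natCast x (n + 1)
    simp only [posInd, if_pos h1, h2, mul_one, Int.cast_add, Int.cast_natCast, Int.cast_one]
  · intro n hn
    have : 0 < n := by
      by_contra h
      exact hn (by simp [posInd, h])
    exact ⟨(n - 1).toNat, by simp; omega⟩

lemma summable_succ_pow (j : ℕ) (hx : ‖x‖ < 1) :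
    Summable fun n : ℕ => ((n : ℂ) + 1) ^ j * x ^ (n + 1) := by
  have h : Summable fun n : ℕ => (n : ℂ) ^ j * x ^ n :=
    summable_pow_mul_geometric_of_norm_lt_one j hx
  exact ((summable_nat_add_iff (f := fun n : ℕ => (n : ℂ) ^ j * x ^ n) 1).2 h).congr
    fun n => by push_cast; rfl

lemma bilateral_posInd_rec (j : ℕ) (hx : ‖x‖ < 1) :
    bilateral posInd j x =
      x * (1 + ∑ i ∈ Finset.range (j + 1), (j.choose i : ℂ) * bilateral posInd i x) := by
  simp only [bilateral_posInd_eq]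
  rw [(summable_succ_pow j hx).tsum_eq_zero_add, mul_add]
  congr 1
  · simp
  · simp only [← tsum_mul_left]
    rw [← Summable.tsum_finsetSum (fun i _ => (summable_succ_pow i hx).mul_left _),
      ← tsum_mul_left]
    refine tsum_congr fun n => ?_
    push_cast
    rw [add_pow, Finset.sum_mul, Finset.mul_sum]
    refine Finset.sum_congr rfl fun i _ => ?_
    ring

lemma bilateral_posInd_zero (hx : ‖x‖ < 1) : bilateral posInd 0 x = x / (1 - x) := by
  have h0 : 1 - x ≠ 0 := sub_ne_zero.2 fun h => by simp [← h] at hx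
  have h := bilateral_posInd_rec 0 hx
  simp at h
  field_simp
  linear_combination h

lemma bilateral_posInd_one (hx : ‖x‖ < 1) : bilateral posInd 1 x = x / (1 - x) ^ 2 := by
  have h0 : 1 - x ≠ 0 := sub_ne_zero.2 fun h => by simp [← h] at hx
  have h := bilateral_posInd_rec 1 hx
  simp [Finset.sum_range_succ, bilateral_posInd_zero hx] at h
  field_simp at h ⊢
  linear_combination h

lemma bilateral_posInd_two (hx : ‖x‖ < 1) :
    bilateral posInd 2 x = x * (1 + x) / (1 - x) ^ 3 := by
  have h0 : 1 - x ≠ 0 := sub_ne_zero.2 fun h => by simp [← h] at hx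
  have h := bilateral_posInd_rec 2 hx
  simp [Finset.sum_range_succ, bilateral_posInd_zero hx, bilateral_posInd_one hx] at h
  field_simp at h ⊢
  linear_combination h

lemma bilateral_posInd_three (hx : ‖x‖ < 1) :
    bilateral posInd 3 x = x * (1 + 4 * x + x ^ 2) / (1 - x) ^ 4 := by
  have h0 : 1 - x ≠ 0 := sub_ne_zero.2 fun h => by simp [← h] at hx
  have h := bilateral_posInd_rec 3 hx
  simp [Finset.sum_range_succ, bilateral_posInd_zero hx, bilateral_posInd_one hx,
    bilateral_posInd_two hx, Nat.choose] at h
  field_simp at h ⊢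
  linear_combination h

end PosInd

section ComplexSums

variable {ι : Type*} {f g : ι → ℂ} {a b : ℂ}

lemma hasSum_complex_add (hf : HasSum f a) (hg : HasSum g b) :
    HasSum (fun i => f i + g i) (a + b) := hf.add hg

lemma hasSum_complex_sub (hf : HasSum f a) (hg : HasSum g b) :
    HasSum (fun i => f i - g i) (a - b) := hf.sub hg

lemma hasSum_complex_mul_left (c : ℂ) (hf : HasSum f a) :
    HasSum (fun i => c * f i) (c * a) := hf.mul_left c

lemma hasSum_complex_congr (hf : HasSum f a) (hfg : ∀ i, g i = f i) (hab : b = a) :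
    HasSum g b := by
  rw [hab, funext hfg]
  exact hf

lemma hasSum_complex_unique (hf : HasSum f a) (hg : HasSum g b) (hfg : ∀ i, f i = g i) :
    a = b := by
  rw [funext hfg] at hf
  exact hf.unique hg

lemma hasSum_complex_single [DecidableEq ι] (i : ι) (c : ℂ) :
    HasSum (fun n => if n = i then c else 0) c := hasSum_ite_eq i c

end ComplexSums

section Products

variable {q x : ℂ}

lemma ne_zero_of_norm_lt {y : ℂ} (h : ‖q‖ < ‖y‖) : y ≠ 0 :=
  norm_pos_iff.1 ((norm_nonneg q).trans_lt h)

lemma lambertCoeff_eq (q : ℂ) :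
    lambertCoeff q = fun n => posInd n + lambertTail q n := by
  funext n; simp [lambertTail]

lemma lambertCoeff_sq_eq (q : ℂ) :
    (fun n => lambertCoeff q n ^ 2) = fun n => posInd n + lambertSqTail q n := by
  funext n; simp [lambertSqTail]

lemma summable_norm_bilateral_lambertCoeff (hq0 : q ≠ 0) (hx : ‖q‖ < ‖x‖) (hx1 : ‖x‖ < 1)
    (j : ℕ) : Summable fun n : ℤ => ‖(n : ℂ) ^ j * lambertCoeff q n * x ^ n‖ := by
  refine Summable.of_nonneg_of_le (fun _ => norm_nonneg _) (fun n => ?_)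
    ((summable_norm_bilateral_posInd j hx1).add
      (summable_norm_bilateral (norm_lambertTail_le hq0 (hx.trans hx1)) j hx hx1.le))
  refine le_of_eq_of_le ?_ (norm_add_le _ _)
  rw [lambertCoeff_eq]
  ring_nf

lemma summable_bilateral_lambertCoeff_sq (hq0 : q ≠ 0) (hx : ‖q‖ < ‖x‖) (hx1 : ‖x‖ < 1)
    (j : ℕ) : Summable fun n : ℤ => (n : ℂ) ^ j * lambertCoeff q n ^ 2 * x ^ n := by
  obtain ⟨M, hM⟩ := exists_norm_lambertSqTail_le hq0 (hx.trans hx1)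
  refine ((summable_norm_bilateral_posInd j hx1).of_norm.add
      (summable_norm_bilateral hM j hx hx1.le).of_norm).congr fun n => ?_
  rw [lambertSqTail]
  ring

lemma bilateral_lambertCoeff (hq0 : q ≠ 0) (hx : ‖q‖ < ‖x‖) (hx1 : ‖x‖ < 1) (j : ℕ) :
    bilateral (lambertCoeff q) j x = bilateral posInd j x + bilateral (lambertTail q) j x := by
  rw [lambertCoeff_eq]
  exact bilateral_add (summable_norm_bilateral_posInd j hx1).of_norm
    (summable_norm_bilateral (norm_lambertTail_le hq0 (hx.trans hx1)) j hx hx1.le).of_norm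

lemma bilateral_lambertCoeff_sq (hq0 : q ≠ 0) (hx : ‖q‖ < ‖x‖) (hx1 : ‖x‖ < 1) (j : ℕ) :
    bilateral (fun n => lambertCoeff q n ^ 2) j x =
      bilateral posInd j x + bilateral (lambertSqTail q) j x := by
  obtain ⟨M, hM⟩ := exists_norm_lambertSqTail_le hq0 (hx.trans hx1)
  rw [lambertCoeff_sq_eq]
  exact bilateral_add (summable_norm_bilateral_posInd j hx1).of_norm
    (summable_norm_bilateral hM j hx hx1.le).of_norm

lemma hasSum_bilateral_lambertCoeff (hq0 : q ≠ 0) (hx : ‖q‖ < ‖x‖) (hx1 : ‖x‖ < 1) (j : ℕ) :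
    HasSum (fun n : ℤ => (n : ℂ) ^ j * lambertCoeff q n * x ^ n)
      (bilateral (lambertCoeff q) j x) :=
  (summable_norm_bilateral_lambertCoeff hq0 hx hx1 j).of_norm.hasSum

lemma hasSum_bilateral_lambertCoeff_sq (hq0 : q ≠ 0) (hx : ‖q‖ < ‖x‖) (hx1 : ‖x‖ < 1) (j : ℕ) :
    HasSum (fun n : ℤ => (n : ℂ) ^ j * lambertCoeff q n ^ 2 * x ^ n)
      (bilateral (fun n => lambertCoeff q n ^ 2) j x) :=
  (summable_bilateral_lambertCoeff_sq hq0 hx hx1 j).hasSum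

lemma hasSum_bilateral_mul (hq0 : q ≠ 0) {y : ℂ} (hx : ‖q‖ < ‖x‖) (hx1 : ‖x‖ < 1)
    (hy : ‖q‖ < ‖y‖) (hy1 : ‖y‖ < 1) (i j : ℕ) :
    HasSum (fun p : ℤ × ℤ => ((p.1 : ℂ) ^ i * lambertCoeff q p.1 * x ^ p.1) *
        ((p.2 : ℂ) ^ j * lambertCoeff q p.2 * y ^ p.2))
      (bilateral (lambertCoeff q) i x * bilateral (lambertCoeff q) j y) := by
  have h1 := summable_norm_bilateral_lambertCoeff hq0 hx hx1 i
  have h2 := summable_norm_bilateral_lambertCoeff hq0 hy hy1 j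
  rw [bilateral, bilateral, tsum_mul_tsum_of_summable_norm h1 h2]
  exact (summable_mul_of_summable_norm h1 h2).hasSum

/-- The coefficient of `x ^ N` in a product of two series `bilateral (lambertCoeff q)`. -/
def lambertConv (q : ℂ) (i j : ℕ) (N : ℤ) : ℂ :=
  ∑' n : ℤ, (n : ℂ) ^ i * ((N - n : ℤ) : ℂ) ^ j * (lambertCoeff q n * lambertCoeff q (N - n))

/-- The bijection `(N, n) ↦ (n, N - n)` of `ℤ × ℤ`. -/
def sumFstEquiv : ℤ × ℤ ≃ ℤ × ℤ where
  toFun p := (p.2, p.1 - p.2)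
  invFun p := (p.1 + p.2, p.1)
  left_inv p := by simp
  right_inv p := by simp

/-- The bijection `(n, k) ↦ (n, n + k)` of `ℤ × ℤ`. -/
def shearEquiv : ℤ × ℤ ≃ ℤ × ℤ where
  toFun p := (p.1, p.1 + p.2)
  invFun p := (p.1, p.2 - p.1)
  left_inv p := by simp
  right_inv p := by simp

lemma hasSum_conv_aux (hq0 : q ≠ 0) (hx : ‖q‖ < ‖x‖) (hx1 : ‖x‖ < 1) (i j : ℕ) :
    HasSum (fun p : ℤ × ℤ => x ^ p.1 * ((p.2 : ℂ) ^ i * ((p.1 - p.2 : ℤ) : ℂ) ^ j *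
        (lambertCoeff q p.2 * lambertCoeff q (p.1 - p.2))))
      (bilateral (lambertCoeff q) i x * bilateral (lambertCoeff q) j x) := by
  have h := (sumFstEquiv.hasSum_iff).2 (hasSum_bilateral_mul hq0 hx hx1 hx hx1 i j)
  refine hasSum_complex_congr h (fun p => ?_) rfl
  have hp : x ^ p.1 = x ^ p.2 * x ^ (p.1 - p.2) := by
    rw [← zpow_add₀ (ne_zero_of_norm_lt hx), add_sub_cancel]
  simp only [sumFstEquiv, Equiv.coe_fn_mk, Function.comp_apply, hp]
  ring

lemma summable_lambertConv (hq0 : q ≠ 0) (hq : ‖q‖ < 1) (i j : ℕ) (N : ℤ) :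
    Summable fun n : ℤ => (n : ℂ) ^ i * ((N - n : ℤ) : ℂ) ^ j *
      (lambertCoeff q n * lambertCoeff q (N - n)) := by
  obtain ⟨r, hr, hr1⟩ := exists_between hq
  have hr0 : 0 < r := (norm_nonneg q).trans_lt hr
  have hn : ‖(r : ℂ)‖ = r := by simp [abs_of_pos hr0]
  have hrN : (r : ℂ) ^ N ≠ 0 := zpow_ne_zero _ (by exact_mod_cast hr0.ne')
  have h := (hasSum_conv_aux hq0 (x := r) (by rwa [hn]) (by rwa [hn]) i j).summable
  have h2 : Summable fun n : ℤ => (r : ℂ) ^ N * ((n : ℂ) ^ i * ((N - n : ℤ) : ℂ) ^ j *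
      (lambertCoeff q n * lambertCoeff q (N - n))) := h.prod_factor N
  exact (hasSum_complex_congr (hasSum_complex_mul_left ((r : ℂ) ^ N)⁻¹ h2.hasSum)
    (fun n => (inv_mul_cancel_left₀ hrN _).symm) rfl).summable

lemma hasSum_lambertConv (hq0 : q ≠ 0) (hx : ‖q‖ < ‖x‖) (hx1 : ‖x‖ < 1) (i j : ℕ) :
    HasSum (fun N : ℤ => x ^ N * lambertConv q i j N)
      (bilateral (lambertCoeff q) i x * bilateral (lambertCoeff q) j x) := by
  refine HasSum.prod_fiberwise (hasSum_conv_aux hq0 hx hx1 i j) fun N => ?_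
  have h : HasSum (fun n : ℤ => (n : ℂ) ^ i * ((N - n : ℤ) : ℂ) ^ j *
      (lambertCoeff q n * lambertCoeff q (N - n))) (lambertConv q i j N) :=
    (summable_lambertConv hq0 (hx.trans hx1) i j N).hasSum
  exact hasSum_complex_mul_left (x ^ N) h

end Products

section Convolution

variable {q : ℂ}

lemma hasSum_posInd_sub_mul_fwdDiff (F : ℤ → ℂ) (N : ℤ) :
    HasSum (fun n : ℤ => (posInd n - if N ≤ n then 1 else 0) * (F (n + 1) - F n))
      (F N - F 1) := by
  have hstep (k : ℤ) (n : ℤ) : ((if k ≤ n then 1 else 0) - if k + 1 ≤ n then 1 else 0 : ℂ) =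
      if n = k then 1 else 0 := by
    rcases lt_trichotomy n k with h | rfl | h
    · simp [not_le.2 h, h.ne, not_le.2 (h.trans (lt_add_one k))]
    · simp
    · simp [h.le, h.ne', Int.add_one_le_iff.2 h]
  induction N using Int.inductionOn' (b := 1) with
  | zero =>
    refine hasSum_complex_congr (f := fun _ => 0) hasSum_zero (fun n => ?_) (sub_self _)
    simp [posInd, Int.lt_iff_add_one_le]
  | succ k _ ih =>
    refine hasSum_complex_congr (hasSum_complex_add ih
      (hasSum_complex_single k (F (k + 1) - F k))) (fun n => ?_) (by ring)
    have h : (if n = k then F (k + 1) - F k else 0) =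
        (if n = k then 1 else 0) * (F (n + 1) - F n) := by
      split_ifs with h <;> simp [h]
    rw [h, ← hstep k n]
    ring
  | pred k _ ih =>
    refine hasSum_complex_congr (hasSum_complex_sub ih
      (hasSum_complex_single (k - 1) (F k - F (k - 1)))) (fun n => ?_) (by ring)
    have h : (if n = k - 1 then F k - F (k - 1) else 0) =
        (if n = k - 1 then 1 else 0) * (F (n + 1) - F n) := by
      split_ifs with h <;> simp [h]
    rw [h, ← hstep (k - 1) n, sub_add_cancel]
    ring

/-- The decomposition of `lambertCoeff q n + lambertCoeff q (N - n) - 1`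
into decaying terms and a finitely supported term. -/
lemma lambertCoeff_add_sub_one (q : ℂ) (N n : ℤ) :
    lambertCoeff q n + lambertCoeff q (N - n) - 1 =
      lambertTail q n + lambertTail q (N - n) + (posInd n - if N ≤ n then 1 else 0) := by
  simp only [lambertTail, posInd, sub_pos]
  by_cases h : N ≤ n
  · simp [h, not_lt.2 h]; ring
  · simp [h, not_le.1 h]; ring

lemma hasSum_pow_mul_lambertTail (hq0 : q ≠ 0) (hq : ‖q‖ < 1) (j : ℕ) :
    HasSum (fun n : ℤ => (n : ℂ) ^ j * lambertTail q n) (bilateral (lambertTail q) j 1) := by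
  have h := (summable_norm_bilateral (norm_lambertTail_le hq0 hq) j (x := 1) (by simpa)
    (by simp)).of_norm
  simpa [bilateral] using h.hasSum

lemma bilateral_lambertTail_inv (hq0 : q ≠ 0) (hq : ‖q‖ < 1) (j : ℕ) (x : ℂ) :
    bilateral (lambertTail q) j x⁻¹ = (-1) ^ (j + 1) * bilateral (lambertTail q) j x := by
  rw [bilateral_neg_arg, pow_succ]
  simp only [lambertTail_neg hq0 hq, bilateral, mul_neg, neg_mul, tsum_neg, mul_one]

lemma bilateral_lambertTail_one_of_even (hq0 : q ≠ 0) (hq : ‖q‖ < 1) {j : ℕ} (hj : Even j) :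
    bilateral (lambertTail q) j 1 = 0 := by
  have h := bilateral_lambertTail_inv hq0 hq j 1
  rw [inv_one, hj.add_one.neg_one_pow] at h
  linear_combination h / 2

lemma hasSum_lambertConv_zero_zero (hq0 : q ≠ 0) (hq : ‖q‖ < 1) {N : ℤ} (hN : N ≠ 0) :
    HasSum (fun n : ℤ => lambertCoeff q n * lambertCoeff q (N - n))
      (lambertCoeff q N * (N + 1 - 2 * lambertCoeff q N)) := by
  have h0 : HasSum (fun n : ℤ => lambertTail q n) 0 :=
    hasSum_complex_congr (hasSum_pow_mul_lambertTail hq0 hq 0) (fun n => by simp)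
      (bilateral_lambertTail_one_of_even hq0 hq Even.zero).symm
  have h1 : HasSum (fun n : ℤ => lambertTail q (N - n)) 0 :=
    hasSum_complex_congr ((Equiv.subLeft N).hasSum_iff.2 h0) (fun n => by simp) rfl
  have h2 := hasSum_complex_mul_left (lambertCoeff q N) (hasSum_complex_add
    (hasSum_complex_add h0 h1) (hasSum_posInd_sub_mul_fwdDiff (fun n => (n : ℂ)) N))
  have h3 := hasSum_complex_sub (hasSum_complex_sub h2
    (hasSum_complex_single (0 : ℤ) (lambertCoeff q N * (lambertCoeff q N - 1))))
    (hasSum_complex_single N (lambertCoeff q N * (lambertCoeff q N - 1)))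
  refine hasSum_complex_congr h3 (fun n => ?_) ?_
  · have key : lambertTail q n + lambertTail q (N - n) +
        (posInd n - if N ≤ n then 1 else 0) * (((n + 1 : ℤ) : ℂ) - n) =
        lambertCoeff q n + lambertCoeff q (N - n) - 1 := by
      rw [lambertCoeff_add_sub_one]; push_cast; ring
    rw [key]
    rcases eq_or_ne n 0 with rfl | hn
    · simp [lambertCoeff_zero, hN.symm]
    rcases eq_or_ne n N with rfl | hn'
    · simp [lambertCoeff_zero, hN]
    rw [lambertCoeff_mul hq0 hq hn (sub_ne_zero.2 hn'.symm) (by simpa)]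
    simp [hn, hn']
  · push_cast; ring

lemma hasSum_lambertConv_one_one (hq0 : q ≠ 0) (hq : ‖q‖ < 1) {N : ℤ} (hN : N ≠ 0) :
    HasSum (fun n : ℤ => (n : ℂ) * ((N - n : ℤ) : ℂ) *
        (lambertCoeff q n * lambertCoeff q (N - n)))
      (lambertCoeff q N * (2 * bilateral (lambertTail q) 1 1 * N + ((N : ℂ) ^ 3 - N) / 6)) := by
  have h0 : HasSum (fun n : ℤ => (n : ℂ) * ((N - n : ℤ) : ℂ) * lambertTail q n)
      (N * bilateral (lambertTail q) 1 1) := by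
    have h := hasSum_complex_sub (hasSum_complex_mul_left (N : ℂ)
      (hasSum_pow_mul_lambertTail hq0 hq 1)) (hasSum_pow_mul_lambertTail hq0 hq 2)
    rw [bilateral_lambertTail_one_of_even hq0 hq even_two, sub_zero] at h
    exact hasSum_complex_congr h (fun n => by push_cast; ring) rfl
  have h1 : HasSum (fun n : ℤ => (n : ℂ) * ((N - n : ℤ) : ℂ) * lambertTail q (N - n))
      (N * bilateral (lambertTail q) 1 1) := by
    refine hasSum_complex_congr ((Equiv.subLeft N).hasSum_iff.2 h0) (fun n => ?_) rfl
    simp only [Function.comp_apply, Equiv.subLeft_apply, sub_sub_cancel]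
    ring
  have h2 := hasSum_complex_mul_left (lambertCoeff q N) (hasSum_complex_add
    (hasSum_complex_add h0 h1) (hasSum_posInd_sub_mul_fwdDiff
    (fun n => (N * n * (n - 1) / 2 - (n - 1) * n * (2 * n - 1) / 6 : ℂ)) N))
  refine hasSum_complex_congr h2 (fun n => ?_) ?_
  · have key : (n : ℂ) * ((N - n : ℤ) : ℂ) * (lambertCoeff q n * lambertCoeff q (N - n)) =
        lambertCoeff q N * (n * ((N - n : ℤ) : ℂ) *
          (lambertCoeff q n + lambertCoeff q (N - n) - 1)) := by
      rcases eq_or_ne n 0 with rfl | hn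
      · simp
      rcases eq_or_ne n N with rfl | hn'
      · simp
      rw [lambertCoeff_mul hq0 hq hn (sub_ne_zero.2 hn'.symm) (by simpa)]
      rw [add_sub_cancel]
      ring
    rw [key, lambertCoeff_add_sub_one]
    push_cast
    ring
  · push_cast; ring

end Convolution

section Identities

variable {q x : ℂ}

lemma bilateral_lambertCoeff_one_sq (hq0 : q ≠ 0) (hx : ‖q‖ < ‖x‖) (hx1 : ‖x‖ < 1) :
    bilateral (lambertCoeff q) 1 x ^ 2 =
      2 * bilateral (lambertTail q) 1 1 * bilateral (lambertCoeff q) 1 x +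
      (bilateral (lambertCoeff q) 3 x - bilateral (lambertCoeff q) 1 x) / 6 +
      lambertConv q 1 1 0 := by
  have hq := hx.trans hx1
  have h := hasSum_lambertConv hq0 hx hx1 1 1
  have hA1 := hasSum_bilateral_lambertCoeff hq0 hx hx1 1
  have hA3 := hasSum_bilateral_lambertCoeff hq0 hx hx1 3
  have h' := hasSum_complex_add (hasSum_complex_add
    (hasSum_complex_mul_left (2 * bilateral (lambertTail q) 1 1) hA1)
    (hasSum_complex_mul_left (1 / 6) (hasSum_complex_sub hA3 hA1)))
    (hasSum_complex_single (0 : ℤ) (lambertConv q 1 1 0))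
  have h'' := hasSum_complex_unique h h' fun N => ?_
  · linear_combination h''
  · rcases eq_or_ne N 0 with rfl | hN
    · simp
    · have h2 : lambertConv q 1 1 N = _ :=
        (hasSum_complex_congr (hasSum_lambertConv_one_one hq0 hq hN)
          (fun n => by rw [pow_one, pow_one]) rfl).tsum_eq
      rw [h2, if_neg hN]
      ring

lemma lambertConv_zero_zero (hq0 : q ≠ 0) (hq : ‖q‖ < 1) {N : ℤ} (hN : N ≠ 0) :
    lambertConv q 0 0 N = lambertCoeff q N * (N + 1 - 2 * lambertCoeff q N) :=
  (hasSum_complex_congr (hasSum_lambertConv_zero_zero hq0 hq hN)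
    (fun n => by rw [pow_zero, pow_zero, one_mul, one_mul]) rfl).tsum_eq

lemma lambertConv_add (hq0 : q ≠ 0) (hq : ‖q‖ < 1) (N : ℤ) :
    lambertConv q 2 0 N + 2 * lambertConv q 1 1 N + lambertConv q 0 2 N =
      N ^ 2 * lambertConv q 0 0 N := by
  have h (i j : ℕ) : HasSum (fun n : ℤ => (n : ℂ) ^ i * ((N - n : ℤ) : ℂ) ^ j *
      (lambertCoeff q n * lambertCoeff q (N - n))) (lambertConv q i j N) :=
    (summable_lambertConv hq0 hq i j N).hasSum
  refine (hasSum_complex_congr (hasSum_complex_add (hasSum_complex_add (h 2 0)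
    (hasSum_complex_mul_left 2 (h 1 1))) (h 0 2)) (fun n => ?_) rfl).unique
    (hasSum_complex_mul_left ((N : ℂ) ^ 2) (h 0 0))
  push_cast
  ring

lemma bilateral_lambertCoeff_zero_sq (hq0 : q ≠ 0) (hx : ‖q‖ < ‖x‖) (hx1 : ‖x‖ < 1) :
    bilateral (lambertCoeff q) 0 x ^ 2 =
      bilateral (lambertCoeff q) 1 x + bilateral (lambertCoeff q) 0 x -
      2 * bilateral (fun n => lambertCoeff q n ^ 2) 0 x + lambertConv q 0 0 0 := by
  have hq := hx.trans hx1
  have h := hasSum_lambertConv hq0 hx hx1 0 0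
  have h' := hasSum_complex_add (hasSum_complex_sub (hasSum_complex_add
    (hasSum_bilateral_lambertCoeff hq0 hx hx1 1) (hasSum_bilateral_lambertCoeff hq0 hx hx1 0))
    (hasSum_complex_mul_left 2 (hasSum_bilateral_lambertCoeff_sq hq0 hx hx1 0)))
    (hasSum_complex_single (0 : ℤ) (lambertConv q 0 0 0))
  have h'' := hasSum_complex_unique h h' fun N => ?_
  · linear_combination h''
  · rcases eq_or_ne N 0 with rfl | hN
    · simp [lambertCoeff_zero]
    · rw [lambertConv_zero_zero hq0 hq hN, if_neg hN]
      ring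

lemma bilateral_lambertCoeff_two_mul_zero (hq0 : q ≠ 0) (hx : ‖q‖ < ‖x‖) (hx1 : ‖x‖ < 1) :
    2 * bilateral (lambertCoeff q) 0 x * bilateral (lambertCoeff q) 2 x +
      2 * bilateral (lambertCoeff q) 1 x ^ 2 =
      bilateral (lambertCoeff q) 3 x + bilateral (lambertCoeff q) 2 x -
      2 * bilateral (fun n => lambertCoeff q n ^ 2) 2 x := by
  have hq := hx.trans hx1
  have h (i j : ℕ) := hasSum_lambertConv hq0 hx hx1 i j
  have h1 := hasSum_complex_add (hasSum_complex_add (h 2 0)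
    (hasSum_complex_mul_left 2 (h 1 1))) (h 0 2)
  have h2 := hasSum_complex_sub (hasSum_complex_add
    (hasSum_bilateral_lambertCoeff hq0 hx hx1 3) (hasSum_bilateral_lambertCoeff hq0 hx hx1 2))
    (hasSum_complex_mul_left 2 (hasSum_bilateral_lambertCoeff_sq hq0 hx hx1 2))
  have h3 := hasSum_complex_unique h1 h2 fun N => ?_
  · linear_combination h3
  · have h4 : (N : ℂ) ^ 2 * lambertConv q 0 0 N =
        N ^ 2 * (lambertCoeff q N * (N + 1 - 2 * lambertCoeff q N)) := by
      rcases eq_or_ne N 0 with rfl | hN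
      · simp
      · rw [lambertConv_zero_zero hq0 hq hN]
    linear_combination x ^ N * h4 + x ^ N * lambertConv_add hq0 hq N

lemma lambertCoeff_mul_neg (hq0 : q ≠ 0) (hq : ‖q‖ < 1) (n : ℤ) :
    lambertCoeff q n * lambertCoeff q (-n) = lambertCoeff q n - lambertCoeff q n ^ 2 := by
  rcases eq_or_ne n 0 with rfl | hn
  · simp [lambertCoeff_zero]
  · rw [lambertCoeff_neg hq0 hq hn]
    ring

/-- The partial fraction identity for `lambertCoeff`, valid for all pairs of integers. -/
lemma lambertCoeff_mul_eq (hq0 : q ≠ 0) (hq : ‖q‖ < 1) (n m : ℤ) :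
    lambertCoeff q n * lambertCoeff q m =
      (if n = m then lambertCoeff q n ^ 2 else 0) +
      lambertCoeff q n * lambertCoeff q (m - n) + lambertCoeff q m * lambertCoeff q (n - m) -
      (if m = 0 then lambertCoeff q n - lambertCoeff q n ^ 2 else 0) -
      (if n = 0 then lambertCoeff q m - lambertCoeff q m ^ 2 else 0) := by
  rw [← lambertCoeff_mul_neg hq0 hq, ← lambertCoeff_mul_neg hq0 hq]
  rcases eq_or_ne n 0 with rfl | hn
  · simp [lambertCoeff_zero]
  rcases eq_or_ne m 0 with rfl | hm
  · simp [lambertCoeff_zero, hn]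
  rcases eq_or_ne n m with rfl | hnm
  · simp [lambertCoeff_zero, hn, ← sq]
  have h1 := lambertCoeff_mul hq0 hq hn (sub_ne_zero.2 hnm.symm) (by simpa)
  have h2 := lambertCoeff_neg hq0 hq (sub_ne_zero.2 hnm.symm)
  rw [neg_sub] at h2
  rw [add_sub_cancel] at h1
  rw [if_neg hnm, if_neg hn, if_neg hm, h1, h2]
  ring

lemma hasSum_prod_of_injective {f : ℤ → ℂ} {a : ℂ} (hf : HasSum f a) {g : ℤ → ℤ × ℤ}
    (hg : Function.Injective g) {F : ℤ × ℤ → ℂ} (hF : ∀ n, F (g n) = f n)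
    (hF0 : ∀ p, p ∉ Set.range g → F p = 0) : HasSum F a :=
  (hg.hasSum_iff hF0).1 (hasSum_complex_congr hf hF rfl)

lemma hasSum_bilateral_shear (hq0 : q ≠ 0) (hx : ‖q‖ < ‖x ^ 2‖) (hx1 : ‖x‖ < 1) (i j : ℕ) :
    HasSum (fun p : ℤ × ℤ => (p.1 : ℂ) ^ i * ((p.2 - p.1 : ℤ) : ℂ) ^ j *
        (lambertCoeff q p.1 * lambertCoeff q (p.2 - p.1)) * (x ^ p.1 * x ^ p.2))
      (bilateral (lambertCoeff q) i (x ^ 2) * bilateral (lambertCoeff q) j x) := by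
  have hx2 : ‖x ^ 2‖ ≤ ‖x‖ := by
    rw [norm_pow]
    exact pow_le_of_le_one (norm_nonneg _) hx1.le two_ne_zero
  have hx0 : x ≠ 0 := ne_zero_of_norm_lt (hx.trans_le hx2)
  have h := (shearEquiv.symm.hasSum_iff).2
    (hasSum_bilateral_mul hq0 hx (hx2.trans_lt hx1) (hx.trans_le hx2) hx1 i j)
  refine hasSum_complex_congr h (fun p => ?_) rfl
  have hp : x ^ p.1 * x ^ p.2 = (x ^ 2) ^ p.1 * x ^ (p.2 - p.1) := by
    rw [← zpow_add₀ hx0, ← zpow_natCast, ← zpow_mul, ← zpow_add₀ hx0]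
    congr 1
    push_cast
    ring
  simp only [shearEquiv, Equiv.coe_fn_symm_mk, Function.comp_apply, hp]
  ring

lemma hasSum_bilateral_shear_swap (hq0 : q ≠ 0) (hx : ‖q‖ < ‖x ^ 2‖) (hx1 : ‖x‖ < 1)
    (i j : ℕ) :
    HasSum (fun p : ℤ × ℤ => (p.2 : ℂ) ^ i * ((p.1 - p.2 : ℤ) : ℂ) ^ j *
        (lambertCoeff q p.2 * lambertCoeff q (p.1 - p.2)) * (x ^ p.2 * x ^ p.1))
      (bilateral (lambertCoeff q) i (x ^ 2) * bilateral (lambertCoeff q) j x) :=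
  ((Equiv.prodComm ℤ ℤ).hasSum_iff).2 (hasSum_bilateral_shear hq0 hx hx1 i j)

lemma hasSum_diagonal (hq0 : q ≠ 0) (hx : ‖q‖ < ‖x ^ 2‖) (hx1 : ‖x‖ < 1) (j : ℕ) :
    HasSum (fun p : ℤ × ℤ => if p.1 = p.2 then
        (p.1 : ℂ) ^ j * lambertCoeff q p.1 ^ 2 * (x ^ p.1 * x ^ p.2) else 0)
      (bilateral (fun n => lambertCoeff q n ^ 2) j (x ^ 2)) := by
  have hx2 : ‖x ^ 2‖ < 1 := by
    rw [norm_pow]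
    exact pow_lt_one₀ (norm_nonneg _) hx1 two_ne_zero
  refine hasSum_prod_of_injective (hasSum_bilateral_lambertCoeff_sq hq0 hx hx2 j)
    (g := fun n => (n, n)) (fun a b h => by simpa using h) (fun n => ?_) fun p hp => ?_
  · simp [sq, mul_zpow]
  · refine if_neg fun h => hp ⟨p.1, ?_⟩
    exact Prod.ext rfl h

lemma bilateral_lambertCoeff_one_sq_shear (hq0 : q ≠ 0) (hx : ‖q‖ < ‖x ^ 2‖) (hx1 : ‖x‖ < 1) :
    bilateral (lambertCoeff q) 1 x ^ 2 =
      bilateral (fun n => lambertCoeff q n ^ 2) 2 (x ^ 2) +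
      2 * bilateral (lambertCoeff q) 2 (x ^ 2) * bilateral (lambertCoeff q) 0 x +
      2 * bilateral (lambertCoeff q) 1 (x ^ 2) * bilateral (lambertCoeff q) 1 x := by
  have hx2 : ‖x ^ 2‖ ≤ ‖x‖ := by
    rw [norm_pow]
    exact pow_le_of_le_one (norm_nonneg _) hx1.le two_ne_zero
  have hx' := hx.trans_le hx2
  have h0 := hasSum_bilateral_mul hq0 hx' hx1 hx' hx1 1 1
  have h1 := hasSum_complex_add (hasSum_complex_add (hasSum_diagonal hq0 hx hx1 2)
    (hasSum_complex_add (hasSum_bilateral_shear hq0 hx hx1 2 0)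
      (hasSum_bilateral_shear hq0 hx hx1 1 1)))
    (hasSum_complex_add (hasSum_bilateral_shear_swap hq0 hx hx1 2 0)
      (hasSum_bilateral_shear_swap hq0 hx hx1 1 1))
  have h2 := hasSum_complex_unique h0 h1 fun p => ?_
  · linear_combination h2
  · have h := lambertCoeff_mul_eq hq0 (hx'.trans hx1) p.1 p.2
    have h3 : (p.1 : ℂ) * p.2 *
        (if p.1 = p.2 then lambertCoeff q p.1 ^ 2 else 0) * (x ^ p.1 * x ^ p.2) =
        if p.1 = p.2 then
        (p.1 : ℂ) ^ 2 * lambertCoeff q p.1 ^ 2 * (x ^ p.1 * x ^ p.2) else 0 := by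
      split_ifs with hp
      · rw [hp]; ring
      · ring
    have h4 : (p.1 : ℂ) * p.2 *
        (if p.2 = 0 then lambertCoeff q p.1 - lambertCoeff q p.1 ^ 2 else 0) = 0 := by
      split_ifs with hp <;> simp [hp]
    have h5 : (p.1 : ℂ) * p.2 *
        (if p.1 = 0 then lambertCoeff q p.2 - lambertCoeff q p.2 ^ 2 else 0) = 0 := by
      split_ifs with hp <;> simp [hp]
    push_cast
    linear_combination (p.1 * p.2 * (x ^ p.1 * x ^ p.2)) * h + h3
      - (x ^ p.1 * x ^ p.2) * h4 - (x ^ p.1 * x ^ p.2) * h5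

lemma bilateral_lambertCoeff_zero_sq_shear (hq0 : q ≠ 0) (hx : ‖q‖ < ‖x ^ 2‖) (hx1 : ‖x‖ < 1) :
    bilateral (lambertCoeff q) 0 x ^ 2 =
      bilateral (fun n => lambertCoeff q n ^ 2) 0 (x ^ 2) +
      2 * bilateral (lambertCoeff q) 0 (x ^ 2) * bilateral (lambertCoeff q) 0 x -
      2 * bilateral (lambertCoeff q) 0 x + 2 * bilateral (fun n => lambertCoeff q n ^ 2) 0 x := by
  have hx2 : ‖x ^ 2‖ ≤ ‖x‖ := by
    rw [norm_pow]
    exact pow_le_of_le_one (norm_nonneg _) hx1.le two_ne_zero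
  have hx' := hx.trans_le hx2
  have h0 := hasSum_bilateral_mul hq0 hx' hx1 hx' hx1 0 0
  have hd := hasSum_complex_sub (hasSum_bilateral_lambertCoeff hq0 hx' hx1 0)
    (hasSum_bilateral_lambertCoeff_sq hq0 hx' hx1 0)
  have hr : HasSum (fun p : ℤ × ℤ => if p.2 = 0 then
      (lambertCoeff q p.1 - lambertCoeff q p.1 ^ 2) * (x ^ p.1 * x ^ p.2) else 0) _ :=
    hasSum_prod_of_injective hd (g := fun n => (n, 0)) (fun a b h => by simpa using h)
      (fun n => by simp; ring) fun p hp => if_neg fun h => hp ⟨p.1, Prod.ext rfl h.symm⟩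
  have hl : HasSum (fun p : ℤ × ℤ => if p.1 = 0 then
      (lambertCoeff q p.2 - lambertCoeff q p.2 ^ 2) * (x ^ p.1 * x ^ p.2) else 0) _ :=
    hasSum_prod_of_injective hd (g := fun n => (0, n)) (fun a b h => by simpa using h)
      (fun n => by simp; ring) fun p hp => if_neg fun h => hp ⟨p.2, Prod.ext h.symm rfl⟩
  have h1 := hasSum_complex_sub (hasSum_complex_sub (hasSum_complex_add (hasSum_complex_add
    (hasSum_diagonal hq0 hx hx1 0) (hasSum_bilateral_shear hq0 hx hx1 0 0))
    (hasSum_bilateral_shear_swap hq0 hx hx1 0 0)) hr) hl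
  have h2 := hasSum_complex_unique h0 h1 fun p => ?_
  · linear_combination h2
  · have h := lambertCoeff_mul_eq hq0 (hx'.trans hx1) p.1 p.2
    have hm (P : Prop) [Decidable P] (a b : ℂ) :
        (if P then a * b else 0) = (if P then a else 0) * b := by
      split_ifs <;> simp
    simp only [hm, pow_zero, one_mul]
    linear_combination (x ^ p.1 * x ^ p.2) * h

end Identities

section BoundaryValues

variable {q : ℂ}

lemma eq_of_eqOn_interior {S : Set ℂ} {F G : ℂ → ℂ} {ρ : ℝ} (hρ0 : 0 ≤ ρ) (hρ : ρ < 1) {ζ : ℂ}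
    (hζ : ‖ζ‖ = 1) (hS : ∀ r : ℝ, ρ ≤ r → r ≤ 1 → (r : ℂ) * ζ ∈ S) (hF : ContinuousOn F S)
    (hG : ContinuousOn G S) (h : ∀ x ∈ S, ‖x‖ < 1 → F x = G x) : F ζ = G ζ := by
  have hc : ContinuousOn (fun r : ℝ => (r : ℂ) * ζ) (Set.Icc ρ 1) := by fun_prop
  have hm : Set.MapsTo (fun r : ℝ => (r : ℂ) * ζ) (Set.Icc ρ 1) S := fun r hr => hS r hr.1 hr.2
  have heq : Set.EqOn (fun r : ℝ => F (r * ζ)) (fun r : ℝ => G (r * ζ)) (Set.Ico ρ 1) := by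
    intro r hr
    refine h _ (hS r hr.1 hr.2.le) ?_
    rw [norm_mul, hζ, mul_one, Complex.norm_real, Real.norm_of_nonneg (hρ0.trans hr.1)]
    exact hr.2
  have h1 := heq.of_subset_closure (hF.comp hc hm) (hG.comp hc hm) Set.Ico_subset_Icc_self
    (closure_Ico hρ.ne).ge (Set.right_mem_Icc.2 hρ.le)
  simpa using h1

/-- The rational function with power series `∑ n ^ j * x ^ n`, for `j ≤ 3`. -/
def geomRat (j : ℕ) (x : ℂ) : ℂ :=
  match j with
  | 0 => x / (1 - x)
  | 1 => x / (1 - x) ^ 2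
  | 2 => x * (1 + x) / (1 - x) ^ 3
  | 3 => x * (1 + 4 * x + x ^ 2) / (1 - x) ^ 4
  | _ => 0

/-- The continuation of `bilateral (lambertCoeff q) j` to the unit circle. -/
def lambertFun (q : ℂ) (j : ℕ) (x : ℂ) : ℂ := geomRat j x + bilateral (lambertTail q) j x

/-- The continuation of `bilateral (fun n => lambertCoeff q n ^ 2) j` to the unit circle. -/
def lambertSqFun (q : ℂ) (j : ℕ) (x : ℂ) : ℂ := geomRat j x + bilateral (lambertSqTail q) j x

lemma bilateral_posInd_eq_geomRat {j : ℕ} (hj : j ≤ 3) {x : ℂ} (hx1 : ‖x‖ < 1) :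
    bilateral posInd j x = geomRat j x := by
  interval_cases j
  · exact bilateral_posInd_zero hx1
  · exact bilateral_posInd_one hx1
  · exact bilateral_posInd_two hx1
  · exact bilateral_posInd_three hx1

lemma bilateral_lambertCoeff_eq_lambertFun (hq0 : q ≠ 0) {j : ℕ} (hj : j ≤ 3) {x : ℂ}
    (hx : ‖q‖ < ‖x‖) (hx1 : ‖x‖ < 1) : bilateral (lambertCoeff q) j x = lambertFun q j x := by
  rw [bilateral_lambertCoeff hq0 hx hx1, bilateral_posInd_eq_geomRat hj hx1, lambertFun]

lemma bilateral_lambertCoeff_sq_eq_lambertSqFun (hq0 : q ≠ 0) {j : ℕ} (hj : j ≤ 3) {x : ℂ}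
    (hx : ‖q‖ < ‖x‖) (hx1 : ‖x‖ < 1) :
    bilateral (fun n => lambertCoeff q n ^ 2) j x = lambertSqFun q j x := by
  rw [bilateral_lambertCoeff_sq hq0 hx hx1, bilateral_posInd_eq_geomRat hj hx1, lambertSqFun]

lemma continuousOn_geomRat (j : ℕ) : ContinuousOn (geomRat j) {x | x ≠ 1} := by
  have h (x : ℂ) (hx : x ∈ {x : ℂ | x ≠ 1}) : 1 - x ≠ 0 := sub_ne_zero.2 (Ne.symm hx)
  unfold geomRat
  split
  · exact ContinuousOn.div (by fun_prop) (by fun_prop) h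
  · exact ContinuousOn.div (by fun_prop) (by fun_prop) fun x hx => pow_ne_zero _ (h x hx)
  · exact ContinuousOn.div (by fun_prop) (by fun_prop) fun x hx => pow_ne_zero _ (h x hx)
  · exact ContinuousOn.div (by fun_prop) (by fun_prop) fun x hx => pow_ne_zero _ (h x hx)
  · exact continuousOn_const

lemma continuousOn_lambertFun (hq0 : q ≠ 0) (hq : ‖q‖ < 1) (j : ℕ) {ρ : ℝ} (hρ : ‖q‖ < ρ) :
    ContinuousOn (lambertFun q j) {x | ρ ≤ ‖x‖ ∧ ‖x‖ ≤ 1 ∧ x ≠ 1} :=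
  ((continuousOn_geomRat j).mono fun _ hx => hx.2.2).add
    ((continuousOn_bilateral (norm_lambertTail_le hq0 hq) j hρ).mono fun _ hx => ⟨hx.1, hx.2.1⟩)

lemma continuousOn_lambertSqFun (hq0 : q ≠ 0) (hq : ‖q‖ < 1) (j : ℕ) {ρ : ℝ} (hρ : ‖q‖ < ρ) :
    ContinuousOn (lambertSqFun q j) {x | ρ ≤ ‖x‖ ∧ ‖x‖ ≤ 1 ∧ x ≠ 1} := by
  obtain ⟨M, hM⟩ := exists_norm_lambertSqTail_le hq0 hq
  exact ((continuousOn_geomRat j).mono fun _ hx => hx.2.2).add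
    ((continuousOn_bilateral hM j hρ).mono fun _ hx => ⟨hx.1, hx.2.1⟩)

/-- A polynomial identity between the functions `lambertFun q j`, `lambertSqFun q j` at `x`
and `x ^ 2` in the open annulus persists on the unit circle. -/
lemma eq_of_forall_annulus (hq : ‖q‖ < 1) {F G : ℂ → ℂ} {ζ : ℂ} (hζ : ‖ζ‖ = 1)
    (hζ2 : ζ ^ 2 ≠ 1)
    (hF : ∀ ρ : ℝ, 0 < ρ → ‖q‖ < ρ ^ 2 → ‖q‖ < ρ →
      ContinuousOn F {x | ρ ≤ ‖x‖ ∧ ‖x‖ ≤ 1 ∧ x ^ 2 ≠ 1})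
    (hG : ∀ ρ : ℝ, 0 < ρ → ‖q‖ < ρ ^ 2 → ‖q‖ < ρ →
      ContinuousOn G {x | ρ ≤ ‖x‖ ∧ ‖x‖ ≤ 1 ∧ x ^ 2 ≠ 1})
    (h : ∀ x : ℂ, ‖q‖ < ‖x ^ 2‖ → ‖x‖ < 1 → F x = G x) : F ζ = G ζ := by
  obtain ⟨m, hm, hm1⟩ := exists_between hq
  have hm0 : 0 < m := (norm_nonneg q).trans_lt hm
  have hρ0 : 0 < √m := Real.sqrt_pos.2 hm0
  have hρ1 : √m < 1 := by rw [Real.sqrt_lt' one_pos]; simpa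
  have hρ2 : √m ^ 2 = m := Real.sq_sqrt hm0.le
  have hρ : ‖q‖ < √m := by
    refine hm.trans ?_
    nlinarith
  refine eq_of_eqOn_interior hρ0.le hρ1 hζ (fun r hr hr1 => ?_) (hF _ hρ0 (by rwa [hρ2]) hρ)
    (hG _ hρ0 (by rwa [hρ2]) hρ) fun x hx hx1 => h x ?_ hx1
  · have hn : ‖(r : ℂ) * ζ‖ = r := by
      rw [norm_mul, hζ, mul_one, Complex.norm_real, Real.norm_of_nonneg (hρ0.le.trans hr)]
    refine ⟨by rwa [hn], by rwa [hn], fun h1 => ?_⟩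
    have h2 : r = 1 := by
      have h3 : r ^ 2 = 1 := by rw [← hn, ← norm_pow, h1, norm_one]
      nlinarith
    rw [h2] at h1
    exact hζ2 (by simpa using h1)
  · rw [norm_pow]
    calc ‖q‖ < √m ^ 2 := by rwa [hρ2]
      _ ≤ ‖x‖ ^ 2 := pow_le_pow_left₀ hρ0.le hx.1 2

lemma continuousOn_lambertFun_annulus (hq0 : q ≠ 0) (hq : ‖q‖ < 1) (j : ℕ) {ρ : ℝ}
    (hρ : ‖q‖ < ρ) :
    ContinuousOn (lambertFun q j) {x | ρ ≤ ‖x‖ ∧ ‖x‖ ≤ 1 ∧ x ^ 2 ≠ 1} :=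
  (continuousOn_lambertFun hq0 hq j hρ).mono fun x hx =>
    ⟨hx.1, hx.2.1, fun h => hx.2.2 (by rw [h, one_pow])⟩

lemma continuousOn_lambertSqFun_annulus (hq0 : q ≠ 0) (hq : ‖q‖ < 1) (j : ℕ) {ρ : ℝ}
    (hρ : ‖q‖ < ρ) :
    ContinuousOn (lambertSqFun q j) {x | ρ ≤ ‖x‖ ∧ ‖x‖ ≤ 1 ∧ x ^ 2 ≠ 1} :=
  (continuousOn_lambertSqFun hq0 hq j hρ).mono fun x hx =>
    ⟨hx.1, hx.2.1, fun h => hx.2.2 (by rw [h, one_pow])⟩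

lemma mapsTo_sq_annulus {ρ : ℝ} (hρ0 : 0 < ρ) :
    Set.MapsTo (fun x : ℂ => x ^ 2) {x | ρ ≤ ‖x‖ ∧ ‖x‖ ≤ 1 ∧ x ^ 2 ≠ 1}
      {x | ρ ^ 2 ≤ ‖x‖ ∧ ‖x‖ ≤ 1 ∧ x ≠ 1} := fun x hx =>
  ⟨by simpa using pow_le_pow_left₀ hρ0.le hx.1 2,
    (norm_pow x 2).trans_le (pow_le_one₀ (norm_nonneg x) hx.2.1), hx.2.2⟩

lemma continuousOn_lambertFun_sq (hq0 : q ≠ 0) (hq : ‖q‖ < 1) (j : ℕ) {ρ : ℝ} (hρ0 : 0 < ρ)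
    (hρ : ‖q‖ < ρ ^ 2) :
    ContinuousOn (fun x => lambertFun q j (x ^ 2)) {x | ρ ≤ ‖x‖ ∧ ‖x‖ ≤ 1 ∧ x ^ 2 ≠ 1} :=
  (continuousOn_lambertFun hq0 hq j hρ).comp (by fun_prop) (mapsTo_sq_annulus hρ0)

lemma continuousOn_lambertSqFun_sq (hq0 : q ≠ 0) (hq : ‖q‖ < 1) (j : ℕ) {ρ : ℝ} (hρ0 : 0 < ρ)
    (hρ : ‖q‖ < ρ ^ 2) :
    ContinuousOn (fun x => lambertSqFun q j (x ^ 2)) {x | ρ ≤ ‖x‖ ∧ ‖x‖ ≤ 1 ∧ x ^ 2 ≠ 1} :=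
  (continuousOn_lambertSqFun hq0 hq j hρ).comp (by fun_prop) (mapsTo_sq_annulus hρ0)

variable {ζ : ℂ}

lemma norm_lt_of_lt_norm_sq {x : ℂ} (hx : ‖q‖ < ‖x ^ 2‖) (hx1 : ‖x‖ < 1) : ‖q‖ < ‖x‖ := by
  rw [norm_pow] at hx
  exact hx.trans_le (pow_le_of_le_one (norm_nonneg _) hx1.le two_ne_zero)

lemma norm_sq_lt_one {x : ℂ} (hx1 : ‖x‖ < 1) : ‖x ^ 2‖ < 1 := by
  rw [norm_pow]
  exact pow_lt_one₀ (norm_nonneg _) hx1 two_ne_zero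

lemma lambertFun_one_sq (hq0 : q ≠ 0) (hq : ‖q‖ < 1) (hζ : ‖ζ‖ = 1) (hζ2 : ζ ^ 2 ≠ 1) :
    lambertFun q 1 ζ ^ 2 =
      2 * bilateral (lambertTail q) 1 1 * lambertFun q 1 ζ +
      (lambertFun q 3 ζ - lambertFun q 1 ζ) / 6 + lambertConv q 1 1 0 := by
  refine eq_of_forall_annulus hq (F := fun x => lambertFun q 1 x ^ 2)
    (G := fun x => 2 * bilateral (lambertTail q) 1 1 * lambertFun q 1 x +
      (lambertFun q 3 x - lambertFun q 1 x) / 6 + lambertConv q 1 1 0) hζ hζ2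
    (fun ρ _ _ h => ?_) (fun ρ _ _ h => ?_) fun x hx hx1 => ?_
  · exact (continuousOn_lambertFun_annulus hq0 hq 1 h).pow 2
  · have h1 := continuousOn_lambertFun_annulus hq0 hq 1 h
    have h3 := continuousOn_lambertFun_annulus hq0 hq 3 h
    fun_prop
  · have hx' := norm_lt_of_lt_norm_sq hx hx1
    simpa (disch := norm_num) only [bilateral_lambertCoeff_eq_lambertFun hq0 _ hx' hx1]
      using bilateral_lambertCoeff_one_sq hq0 hx' hx1

lemma lambertFun_zero_sq (hq0 : q ≠ 0) (hq : ‖q‖ < 1) (hζ : ‖ζ‖ = 1) (hζ2 : ζ ^ 2 ≠ 1) :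
    lambertFun q 0 ζ ^ 2 =
      lambertFun q 1 ζ + lambertFun q 0 ζ - 2 * lambertSqFun q 0 ζ + lambertConv q 0 0 0 := by
  refine eq_of_forall_annulus hq (F := fun x => lambertFun q 0 x ^ 2)
    (G := fun x => lambertFun q 1 x + lambertFun q 0 x - 2 * lambertSqFun q 0 x +
      lambertConv q 0 0 0) hζ hζ2 (fun ρ _ _ h => ?_) (fun ρ _ _ h => ?_) fun x hx hx1 => ?_
  · exact (continuousOn_lambertFun_annulus hq0 hq 0 h).pow 2
  · have h1 := continuousOn_lambertFun_annulus hq0 hq 1 h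
    have h3 := continuousOn_lambertFun_annulus hq0 hq 0 h
    have h4 := continuousOn_lambertSqFun_annulus hq0 hq 0 h
    fun_prop
  · have hx' := norm_lt_of_lt_norm_sq hx hx1
    simpa (disch := norm_num) only [bilateral_lambertCoeff_eq_lambertFun hq0 _ hx' hx1,
      bilateral_lambertCoeff_sq_eq_lambertSqFun hq0 _ hx' hx1]
      using bilateral_lambertCoeff_zero_sq hq0 hx' hx1

lemma lambertFun_two_mul_zero (hq0 : q ≠ 0) (hq : ‖q‖ < 1) (hζ : ‖ζ‖ = 1) (hζ2 : ζ ^ 2 ≠ 1) :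
    2 * lambertFun q 0 ζ * lambertFun q 2 ζ + 2 * lambertFun q 1 ζ ^ 2 =
      lambertFun q 3 ζ + lambertFun q 2 ζ - 2 * lambertSqFun q 2 ζ := by
  refine eq_of_forall_annulus hq
    (F := fun x => 2 * lambertFun q 0 x * lambertFun q 2 x + 2 * lambertFun q 1 x ^ 2)
    (G := fun x => lambertFun q 3 x + lambertFun q 2 x - 2 * lambertSqFun q 2 x) hζ hζ2
    (fun ρ _ _ h => ?_) (fun ρ _ _ h => ?_) fun x hx hx1 => ?_
  · have h0 := continuousOn_lambertFun_annulus hq0 hq 0 h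
    have h1 := continuousOn_lambertFun_annulus hq0 hq 1 h
    have h2 := continuousOn_lambertFun_annulus hq0 hq 2 h
    fun_prop
  · have h1 := continuousOn_lambertFun_annulus hq0 hq 2 h
    have h3 := continuousOn_lambertFun_annulus hq0 hq 3 h
    have h4 := continuousOn_lambertSqFun_annulus hq0 hq 2 h
    fun_prop
  · have hx' := norm_lt_of_lt_norm_sq hx hx1
    simpa (disch := norm_num) only [bilateral_lambertCoeff_eq_lambertFun hq0 _ hx' hx1,
      bilateral_lambertCoeff_sq_eq_lambertSqFun hq0 _ hx' hx1]
      using bilateral_lambertCoeff_two_mul_zero hq0 hx' hx1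

lemma lambertFun_one_sq_shear (hq0 : q ≠ 0) (hq : ‖q‖ < 1) (hζ : ‖ζ‖ = 1) (hζ2 : ζ ^ 2 ≠ 1) :
    lambertFun q 1 ζ ^ 2 =
      lambertSqFun q 2 (ζ ^ 2) + 2 * lambertFun q 2 (ζ ^ 2) * lambertFun q 0 ζ +
      2 * lambertFun q 1 (ζ ^ 2) * lambertFun q 1 ζ := by
  refine eq_of_forall_annulus hq (F := fun x => lambertFun q 1 x ^ 2)
    (G := fun x => lambertSqFun q 2 (x ^ 2) + 2 * lambertFun q 2 (x ^ 2) * lambertFun q 0 x +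
      2 * lambertFun q 1 (x ^ 2) * lambertFun q 1 x) hζ hζ2
    (fun ρ _ _ h => ?_) (fun ρ hρ h' h => ?_) fun x hx hx1 => ?_
  · exact (continuousOn_lambertFun_annulus hq0 hq 1 h).pow 2
  · have h0 := continuousOn_lambertFun_annulus hq0 hq 0 h
    have h1 := continuousOn_lambertFun_annulus hq0 hq 1 h
    have h2 := continuousOn_lambertFun_sq hq0 hq 2 hρ h'
    have h3 := continuousOn_lambertFun_sq hq0 hq 1 hρ h'
    have h4 := continuousOn_lambertSqFun_sq hq0 hq 2 hρ h'
    fun_prop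
  · have hx' := norm_lt_of_lt_norm_sq hx hx1
    simpa (disch := norm_num) only [bilateral_lambertCoeff_eq_lambertFun hq0 _ hx' hx1,
      bilateral_lambertCoeff_eq_lambertFun hq0 _ hx (norm_sq_lt_one hx1),
      bilateral_lambertCoeff_sq_eq_lambertSqFun hq0 _ hx (norm_sq_lt_one hx1)]
      using bilateral_lambertCoeff_one_sq_shear hq0 hx hx1

lemma lambertFun_zero_sq_shear (hq0 : q ≠ 0) (hq : ‖q‖ < 1) (hζ : ‖ζ‖ = 1) (hζ2 : ζ ^ 2 ≠ 1) :
    lambertFun q 0 ζ ^ 2 =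
      lambertSqFun q 0 (ζ ^ 2) + 2 * lambertFun q 0 (ζ ^ 2) * lambertFun q 0 ζ -
      2 * lambertFun q 0 ζ + 2 * lambertSqFun q 0 ζ := by
  refine eq_of_forall_annulus hq (F := fun x => lambertFun q 0 x ^ 2)
    (G := fun x => lambertSqFun q 0 (x ^ 2) + 2 * lambertFun q 0 (x ^ 2) * lambertFun q 0 x -
      2 * lambertFun q 0 x + 2 * lambertSqFun q 0 x) hζ hζ2
    (fun ρ _ _ h => ?_) (fun ρ hρ h' h => ?_) fun x hx hx1 => ?_
  · exact (continuousOn_lambertFun_annulus hq0 hq 0 h).pow 2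
  · have h0 := continuousOn_lambertFun_annulus hq0 hq 0 h
    have h1 := continuousOn_lambertSqFun_annulus hq0 hq 0 h
    have h2 := continuousOn_lambertFun_sq hq0 hq 0 hρ h'
    have h4 := continuousOn_lambertSqFun_sq hq0 hq 0 hρ h'
    fun_prop
  · have hx' := norm_lt_of_lt_norm_sq hx hx1
    simpa (disch := norm_num) only [bilateral_lambertCoeff_eq_lambertFun hq0 _ hx' hx1,
      bilateral_lambertCoeff_sq_eq_lambertSqFun hq0 _ hx' hx1,
      bilateral_lambertCoeff_eq_lambertFun hq0 _ hx (norm_sq_lt_one hx1),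
      bilateral_lambertCoeff_sq_eq_lambertSqFun hq0 _ hx (norm_sq_lt_one hx1)]
      using bilateral_lambertCoeff_zero_sq_shear hq0 hx hx1

lemma bilateral_lambertSqTail_inv (hq0 : q ≠ 0) (hq : ‖q‖ < 1) (j : ℕ) (hζ : ‖ζ‖ = 1) :
    bilateral (lambertSqTail q) j ζ⁻¹ =
      (-1) ^ j * (bilateral (lambertSqTail q) j ζ - 2 * bilateral (lambertTail q) j ζ) := by
  obtain ⟨M, hM⟩ := exists_norm_lambertSqTail_le hq0 hq
  have h1 := (summable_norm_bilateral hM j (x := ζ) (by rwa [hζ]) hζ.le).of_norm.hasSum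
  have h2 := (summable_norm_bilateral (norm_lambertTail_le hq0 hq) j (x := ζ)
    (by rwa [hζ]) hζ.le).of_norm.hasSum
  rw [bilateral_neg_arg]
  congr 1
  refine (hasSum_complex_congr (hasSum_complex_sub h1 (hasSum_complex_mul_left 2 h2))
    (fun n => ?_) rfl).tsum_eq
  simp only [lambertSqTail_neg hq0 hq]
  ring

end BoundaryValues

section CubeRoot

variable {q ζ : ℂ}

lemma cubeRoot_ne_one (h3 : 1 + ζ + ζ ^ 2 = 0) : 1 - ζ ≠ 0 := by
  intro h
  rw [← sub_eq_zero.1 h] at h3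
  norm_num at h3

lemma cubeRoot_sq_ne_one (h3 : 1 + ζ + ζ ^ 2 = 0) : ζ ^ 2 ≠ 1 := by
  intro h
  have h1 : ζ = -2 := by linear_combination h3 - h
  rw [h1] at h
  norm_num at h

lemma cubeRoot_pow_three (h3 : 1 + ζ + ζ ^ 2 = 0) : ζ ^ 3 = 1 := by
  linear_combination (ζ - 1) * h3

lemma norm_cubeRoot (h3 : 1 + ζ + ζ ^ 2 = 0) : ‖ζ‖ = 1 :=
  Complex.norm_eq_one_of_pow_eq_one (cubeRoot_pow_three h3) three_ne_zero

lemma cubeRoot_sq_eq_inv (h3 : 1 + ζ + ζ ^ 2 = 0) : ζ ^ 2 = ζ⁻¹ :=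
  eq_inv_of_mul_eq_one_left (by linear_combination (ζ - 1) * h3)

lemma geomRat_zero_cubeRoot (h3 : 1 + ζ + ζ ^ 2 = 0) : geomRat 0 ζ = (ζ - 1) / 3 := by
  have h := cubeRoot_ne_one h3
  simp only [geomRat]
  rw [div_eq_div_iff h three_ne_zero]
  linear_combination h3

lemma geomRat_one_cubeRoot (h3 : 1 + ζ + ζ ^ 2 = 0) : geomRat 1 ζ = -1 / 3 := by
  have h := cubeRoot_ne_one h3
  simp only [geomRat]
  rw [div_eq_div_iff (pow_ne_zero _ h) three_ne_zero]
  linear_combination h3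

lemma geomRat_two_cubeRoot (h3 : 1 + ζ + ζ ^ 2 = 0) : geomRat 2 ζ = -(2 * ζ + 1) / 9 := by
  have h := cubeRoot_ne_one h3
  simp only [geomRat]
  rw [div_eq_div_iff (pow_ne_zero _ h) (by norm_num)]
  linear_combination (1 + 7 * ζ - 2 * ζ ^ 2) * h3

lemma geomRat_three_cubeRoot (h3 : 1 + ζ + ζ ^ 2 = 0) : geomRat 3 ζ = 1 / 3 := by
  have h := cubeRoot_ne_one h3
  simp only [geomRat]
  rw [div_eq_div_iff (pow_ne_zero _ h) three_ne_zero]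
  linear_combination (-1 + 8 * ζ - ζ ^ 2) * h3

lemma cubeRoot_sq_root (h3 : 1 + ζ + ζ ^ 2 = 0) : 1 + ζ ^ 2 + (ζ ^ 2) ^ 2 = 0 := by
  linear_combination (1 - ζ + ζ ^ 2) * h3

lemma lambertFun_zero_cubeRoot_sq (hq0 : q ≠ 0) (hq : ‖q‖ < 1) (h3 : 1 + ζ + ζ ^ 2 = 0) :
    lambertFun q 0 (ζ ^ 2) = -1 - lambertFun q 0 ζ := by
  rw [lambertFun, lambertFun, geomRat_zero_cubeRoot (cubeRoot_sq_root h3),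
    geomRat_zero_cubeRoot h3, cubeRoot_sq_eq_inv h3, bilateral_lambertTail_inv hq0 hq,
    ← cubeRoot_sq_eq_inv h3]
  linear_combination h3 / 3

lemma lambertFun_one_cubeRoot_sq (hq0 : q ≠ 0) (hq : ‖q‖ < 1) (h3 : 1 + ζ + ζ ^ 2 = 0) :
    lambertFun q 1 (ζ ^ 2) = lambertFun q 1 ζ := by
  rw [lambertFun, lambertFun, geomRat_one_cubeRoot (cubeRoot_sq_root h3),
    geomRat_one_cubeRoot h3, cubeRoot_sq_eq_inv h3, bilateral_lambertTail_inv hq0 hq]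
  ring

lemma lambertFun_two_cubeRoot_sq (hq0 : q ≠ 0) (hq : ‖q‖ < 1) (h3 : 1 + ζ + ζ ^ 2 = 0) :
    lambertFun q 2 (ζ ^ 2) = -lambertFun q 2 ζ := by
  rw [lambertFun, lambertFun, geomRat_two_cubeRoot (cubeRoot_sq_root h3),
    geomRat_two_cubeRoot h3, cubeRoot_sq_eq_inv h3, bilateral_lambertTail_inv hq0 hq,
    ← cubeRoot_sq_eq_inv h3]
  linear_combination -2 * h3 / 9

lemma lambertSqFun_zero_cubeRoot_sq (hq0 : q ≠ 0) (hq : ‖q‖ < 1) (h3 : 1 + ζ + ζ ^ 2 = 0) :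
    lambertSqFun q 0 (ζ ^ 2) = -1 - 2 * lambertFun q 0 ζ + lambertSqFun q 0 ζ := by
  rw [lambertFun, lambertSqFun, lambertSqFun, geomRat_zero_cubeRoot (cubeRoot_sq_root h3),
    geomRat_zero_cubeRoot h3, cubeRoot_sq_eq_inv h3,
    bilateral_lambertSqTail_inv hq0 hq 0 (norm_cubeRoot h3), ← cubeRoot_sq_eq_inv h3]
  linear_combination h3 / 3

lemma lambertSqFun_two_cubeRoot_sq (hq0 : q ≠ 0) (hq : ‖q‖ < 1) (h3 : 1 + ζ + ζ ^ 2 = 0) :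
    lambertSqFun q 2 (ζ ^ 2) = lambertSqFun q 2 ζ - 2 * lambertFun q 2 ζ := by
  rw [lambertFun, lambertSqFun, lambertSqFun, geomRat_two_cubeRoot (cubeRoot_sq_root h3),
    geomRat_two_cubeRoot h3, cubeRoot_sq_eq_inv h3,
    bilateral_lambertSqTail_inv hq0 hq 2 (norm_cubeRoot h3), ← cubeRoot_sq_eq_inv h3]
  linear_combination -2 * h3 / 9

lemma lambertFun_three_cubeRoot (hq0 : q ≠ 0) (hq : ‖q‖ < 1) (h3 : 1 + ζ + ζ ^ 2 = 0) :
    lambertFun q 3 ζ = 3 * lambertFun q 2 ζ * (2 * lambertFun q 0 ζ + 1) := by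
  have h1 := lambertFun_one_sq_shear hq0 hq (norm_cubeRoot h3) (cubeRoot_sq_ne_one h3)
  have h2 := lambertFun_two_mul_zero hq0 hq (norm_cubeRoot h3) (cubeRoot_sq_ne_one h3)
  rw [lambertSqFun_two_cubeRoot_sq hq0 hq h3, lambertFun_two_cubeRoot_sq hq0 hq h3,
    lambertFun_one_cubeRoot_sq hq0 hq h3] at h1
  linear_combination -2 * h1 - h2

lemma lambertFun_zero_one_cubeRoot (hq0 : q ≠ 0) (hq : ‖q‖ < 1) (h3 : 1 + ζ + ζ ^ 2 = 0) :
    9 * lambertFun q 0 ζ ^ 2 + 9 * lambertFun q 0 ζ + 2 =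
      3 * lambertFun q 1 ζ + 3 * lambertConv q 0 0 0 := by
  have h1 := lambertFun_zero_sq_shear hq0 hq (norm_cubeRoot h3) (cubeRoot_sq_ne_one h3)
  have h2 := lambertFun_zero_sq hq0 hq (norm_cubeRoot h3) (cubeRoot_sq_ne_one h3)
  rw [lambertSqFun_zero_cubeRoot_sq hq0 hq h3, lambertFun_zero_cubeRoot_sq hq0 hq h3] at h1
  linear_combination 2 * h1 + 3 * h2

end CubeRoot

section PNatSums

variable {q : ℂ}

lemma summable_pow_mul_lambertTail (hq0 : q ≠ 0) (hq : ‖q‖ < 1) (j : ℕ) {x : ℂ} (hx : ‖x‖ = 1) :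
    Summable fun n : ℤ => (n : ℂ) ^ j * lambertTail q n * x ^ n :=
  (summable_norm_bilateral (norm_lambertTail_le hq0 hq) j (by rwa [hx]) hx.le).of_norm

/-- A bilateral series of `lambertTail` on the unit circle as a series over the positive
integers. -/
lemma bilateral_lambertTail_eq_tsum_pnat (hq0 : q ≠ 0) (hq : ‖q‖ < 1) (j : ℕ) {x : ℂ}
    (hx : ‖x‖ = 1) :
    bilateral (lambertTail q) j x = ∑' n : ℕ+, (x ^ (n : ℕ) + (-1) ^ (j + 1) * x⁻¹ ^ (n : ℕ)) *
      ((n : ℂ) ^ j * q ^ (n : ℕ) / (1 - q ^ (n : ℕ))) := by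
  have hs := summable_pow_mul_lambertTail hq0 hq j hx
  have h1 : Summable fun n : ℕ+ => ((n : ℤ) : ℂ) ^ j * lambertTail q (n : ℤ) * x ^ (n : ℤ) :=
    hs.comp_injective (i := fun n : ℕ+ => (n : ℤ)) fun a b h => by simpa using h
  have h2 : Summable fun n : ℕ+ =>
      ((-(n : ℤ) : ℤ) : ℂ) ^ j * lambertTail q (-(n : ℤ)) * x ^ (-(n : ℤ)) :=
    hs.comp_injective (i := fun n : ℕ+ => -(n : ℤ)) fun a b h => by simpa using h
  rw [bilateral, tsum_int_eq_zero_add_tsum_pnat hs, add_assoc, ← h1.tsum_add h2]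
  simp only [lambertTail_zero, mul_zero, zero_mul, zero_add]
  refine tsum_congr fun n => ?_
  have h3 : lambertTail q (n : ℤ) = q ^ (n : ℕ) / (1 - q ^ (n : ℕ)) :=
    lambertTail_natCast hq n
  rw [lambertTail_neg hq0 hq, h3, zpow_neg, zpow_natCast, inv_pow, Int.cast_neg, neg_pow,
    Int.cast_natCast]
  ring

open scoped ArithmeticFunction.sigma in
lemma bilateral_lambertTail_one_of_odd (hq0 : q ≠ 0) (hq : ‖q‖ < 1) {j : ℕ} (hj : Odd j) :
    bilateral (lambertTail q) j 1 = 2 * ∑' n : ℕ+, (σ j n : ℂ) * q ^ (n : ℕ) := by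
  rw [bilateral_lambertTail_eq_tsum_pnat hq0 hq j norm_one, hj.add_one.neg_one_pow,
    ← tsum_pow_div_one_sub_eq_tsum_sigma hq, ← tsum_mul_left]
  refine tsum_congr fun n => ?_
  norm_num

lemma lambertConv_zero_zero_zero (hq0 : q ≠ 0) (hq : ‖q‖ < 1) :
    lambertConv q 0 0 0 = -bilateral (lambertTail q) 1 1 := by
  have hs := summable_lambertConv hq0 hq 0 0 0
  simp only [pow_zero, one_mul, zero_sub] at hs
  have he : Function.Even fun n : ℤ => lambertCoeff q n * lambertCoeff q (-n) := fun n => by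
    simp only [neg_neg, mul_comm]
  rw [bilateral_lambertTail_one_of_odd hq0 hq odd_one, ← tsum_prod_pow_eq_tsum_sigma 1 hq,
    lambertConv]
  simp only [pow_zero, one_mul, zero_sub]
  rw [tsum_int_eq_zero_add_two_mul_tsum_pnat he hs, lambertCoeff_zero, zero_mul, zero_add,
    nsmul_eq_mul, Nat.cast_ofNat, ← mul_neg, ← tsum_neg]
  congr 1
  refine tsum_congr fun n => ?_
  have hqn : ‖q ^ (n : ℕ)‖ < 1 := by
    rw [norm_pow]
    exact pow_lt_one₀ (norm_nonneg _) hq n.ne_zero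
  have h1 := tsum_coe_mul_geometric_of_norm_lt_one hqn
  rw [← tsum_pnat_eq_tsum_of_eq_zero (by simp)] at h1
  simp only [pow_one, pow_mul]
  rw [h1, lambertCoeff_mul_neg hq0 hq, lambertCoeff, zpow_natCast]
  have h2 : 1 - q ^ (n : ℕ) ≠ 0 := sub_ne_zero.2 fun h => by simp [← h] at hqn
  field_simp
  ring

end PNatSums

section LimitAtOne

variable {q : ℂ}

/-- The Laurent polynomial `x * (x ^ k + x ^ (-k) - 2) / (1 - x) ^ 2`. -/
def diffKernel (k : ℕ) (x : ℂ) : ℂ := x * x⁻¹ ^ k * (∑ i ∈ Finset.range k, x ^ i) ^ 2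

lemma diffKernel_eq {x : ℂ} (hx : x ≠ 0) (hx1 : 1 - x ≠ 0) (k : ℕ) :
    diffKernel k x = x / (1 - x) ^ 2 * (x ^ k + x⁻¹ ^ k - 2) := by
  have h1 := geom_sum_mul_neg x k
  have h2 : x⁻¹ ^ k * x ^ k = 1 := by rw [← mul_pow, inv_mul_cancel₀ hx, one_pow]
  rw [diffKernel, div_mul_eq_mul_div, eq_div_iff (pow_ne_zero _ hx1)]
  calc x * x⁻¹ ^ k * (∑ i ∈ Finset.range k, x ^ i) ^ 2 * (1 - x) ^ 2
      = x * x⁻¹ ^ k * ((∑ i ∈ Finset.range k, x ^ i) * (1 - x)) ^ 2 := by ring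
    _ = x * (x ^ k + x⁻¹ ^ k - 2) := by
      rw [h1]
      linear_combination (x * (x ^ k - 2)) * h2

lemma diffKernel_one (k : ℕ) : diffKernel k 1 = (k : ℂ) ^ 2 := by
  simp [diffKernel]

lemma norm_diffKernel_le {ρ : ℝ} (hρ : 0 < ρ) {x : ℂ} (hx : ρ ≤ ‖x‖) (hx1 : ‖x‖ ≤ 1) (k : ℕ) :
    ‖diffKernel k x‖ ≤ ρ⁻¹ ^ k * (k : ℝ) ^ 2 := by
  have h1 : ‖∑ i ∈ Finset.range k, x ^ i‖ ≤ k := by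
    refine (norm_sum_le _ _).trans ?_
    refine (Finset.sum_le_card_nsmul _ _ 1 fun i _ => ?_).trans (by simp)
    rw [norm_pow]
    exact pow_le_one₀ (norm_nonneg _) hx1
  rw [diffKernel, norm_mul, norm_mul, norm_pow, norm_pow, norm_inv]
  have h2 : ‖x‖⁻¹ ^ k ≤ ρ⁻¹ ^ k :=
    pow_le_pow_left₀ (by positivity) (inv_anti₀ hρ hx) k
  calc ‖x‖ * ‖x‖⁻¹ ^ k * ‖∑ i ∈ Finset.range k, x ^ i‖ ^ 2
      ≤ 1 * ρ⁻¹ ^ k * (k : ℝ) ^ 2 := by gcongr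
    _ = ρ⁻¹ ^ k * (k : ℝ) ^ 2 := by ring

/-- The continuation of `2 * x / (1 - x) ^ 2 * (bilateral (lambertTail q) 1 x -
bilateral (lambertTail q) 1 1)` to `x = 1`. -/
def kernelSum (q x : ℂ) : ℂ := ∑' n : ℤ, (n * lambertTail q n) * diffKernel n.natAbs x

lemma continuousOn_kernelSum (hq0 : q ≠ 0) (hq : ‖q‖ < 1) {ρ : ℝ} (hρ : ‖q‖ < ρ) :
    ContinuousOn (kernelSum q) {x | ρ ≤ ‖x‖ ∧ ‖x‖ ≤ 1} := by
  have hρ0 : 0 < ρ := (norm_nonneg q).trans_lt hρ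
  refine continuousOn_tsum (fun n => ?_)
    ((summable_natAbs_pow_mul_geometric 3 (s := ‖q‖ / ρ) (by positivity)
      ((div_lt_one hρ0).2 hρ)).mul_left (1 - ‖q‖)⁻¹) (fun n x hx => ?_)
  · have hi : ContinuousOn (fun x : ℂ => x⁻¹) {x | ρ ≤ ‖x‖ ∧ ‖x‖ ≤ 1} :=
      continuousOn_id.inv₀ fun x hx => norm_pos_iff.1 (hρ0.trans_le hx.1)
    unfold diffKernel
    fun_prop
  · rw [norm_mul, norm_mul, norm_intCast_eq_natAbs]
    calc (n.natAbs : ℝ) * ‖lambertTail q n‖ * ‖diffKernel n.natAbs x‖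
        ≤ n.natAbs * ((1 - ‖q‖)⁻¹ * ‖q‖ ^ n.natAbs) * (ρ⁻¹ ^ n.natAbs * (n.natAbs : ℝ) ^ 2) := by
          gcongr
          · exact norm_lambertTail_le hq0 hq n
          · exact norm_diffKernel_le hρ0 hx.1 hx.2 _
      _ = (1 - ‖q‖)⁻¹ * ((n.natAbs : ℝ) ^ 3 * (‖q‖ / ρ) ^ n.natAbs) := by
          rw [div_eq_mul_inv, mul_pow]
          ring

lemma kernelSum_one (hq0 : q ≠ 0) (hq : ‖q‖ < 1) :
    kernelSum q 1 = bilateral (lambertTail q) 3 1 := by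
  rw [← (hasSum_pow_mul_lambertTail hq0 hq 3).tsum_eq, kernelSum]
  refine tsum_congr fun n => ?_
  have h : ((n.natAbs : ℂ)) ^ 2 = (n : ℂ) ^ 2 := by
    rw [← Int.cast_natCast, ← Int.cast_pow, Int.natAbs_sq, Int.cast_pow]
  rw [diffKernel_one, h]
  ring

lemma kernelSum_eq (hq0 : q ≠ 0) {x : ℂ} (hx : ‖q‖ < ‖x‖) (hx1 : ‖x‖ < 1) :
    kernelSum q x = 2 * geomRat 1 x *
      (bilateral (lambertTail q) 1 x - bilateral (lambertTail q) 1 1) := by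
  have hq := hx.trans hx1
  have h1 : HasSum (fun n : ℤ => (n : ℂ) ^ 1 * lambertTail q n * x ^ n)
      (bilateral (lambertTail q) 1 x) :=
    (summable_norm_bilateral (norm_lambertTail_le hq0 hq) 1 hx hx1.le).of_norm.hasSum
  have h2 : HasSum (fun n : ℤ => (n : ℂ) * lambertTail q n * x⁻¹ ^ n)
      (bilateral (lambertTail q) 1 x) := by
    refine hasSum_complex_congr ((Equiv.neg ℤ).hasSum_iff.2 h1) (fun n => ?_) rfl
    simp only [Function.comp_apply, Equiv.neg_apply, lambertTail_neg hq0 hq, inv_zpow']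
    push_cast
    ring
  have hx0 : x ≠ 0 := ne_zero_of_norm_lt hx
  have h0 : 1 - x ≠ 0 := sub_ne_zero.2 fun h => by simp [← h] at hx1
  refine (hasSum_complex_congr (hasSum_complex_mul_left (x / (1 - x) ^ 2) (hasSum_complex_sub
    (hasSum_complex_add h1 h2) (hasSum_complex_mul_left 2 (hasSum_pow_mul_lambertTail hq0 hq 1))))
    (fun n => ?_) ?_).tsum_eq
  · have h3 : x ^ n.natAbs + x⁻¹ ^ n.natAbs = x ^ n + x⁻¹ ^ n := by
      obtain ⟨k, rfl | rfl⟩ := n.eq_nat_or_neg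
      · simp
      · simp [add_comm]
    rw [diffKernel_eq hx0 h0, h3]
    ring
  · rw [geomRat]
    ring

lemma bilateral_lambertTail_one_sq (hq0 : q ≠ 0) (hq : ‖q‖ < 1) :
    bilateral (lambertTail q) 1 1 ^ 2 =
      5 / 6 * bilateral (lambertTail q) 3 1 + bilateral (lambertTail q) 1 1 / 6 -
      lambertConv q 1 1 0 := by
  obtain ⟨ρ, hρ, hρ1⟩ := exists_between hq
  have hρ0 : 0 < ρ := (norm_nonneg q).trans_lt hρ
  have h1 := continuousOn_bilateral (norm_lambertTail_le hq0 hq) 1 hρ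
  have h3 := continuousOn_bilateral (norm_lambertTail_le hq0 hq) 3 hρ
  have hk := continuousOn_kernelSum hq0 hq hρ
  have key := eq_of_eqOn_interior (S := {x | ρ ≤ ‖x‖ ∧ ‖x‖ ≤ 1})
    (F := fun x => kernelSum q x + bilateral (lambertTail q) 1 x ^ 2)
    (G := fun x => 2 * bilateral (lambertTail q) 1 1 * bilateral (lambertTail q) 1 x +
      (bilateral (lambertTail q) 3 x - bilateral (lambertTail q) 1 x) / 6 + lambertConv q 1 1 0)
    hρ0.le hρ1 norm_one (fun r hr hr1 => ?_) (by fun_prop) (by fun_prop) fun x hx hx1 => ?_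
  · simp only [kernelSum_one hq0 hq] at key
    linear_combination -key
  · simpa [abs_of_nonneg (hρ0.le.trans hr)] using And.intro hr hr1
  · have hqx := hρ.trans_le hx.1
    have h := bilateral_lambertCoeff_one_sq hq0 hqx hx1
    rw [bilateral_lambertCoeff_eq_lambertFun hq0 (by norm_num) hqx hx1,
      bilateral_lambertCoeff_eq_lambertFun hq0 le_rfl hqx hx1, lambertFun, lambertFun] at h
    have h0 : 1 - x ≠ 0 := sub_ne_zero.2 fun h => by simp [← h] at hx1
    have hg : geomRat 3 x = geomRat 1 x + 6 * geomRat 1 x ^ 2 := by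
      simp only [geomRat]
      field_simp
      ring
    simp only [kernelSum_eq hq0 hqx hx1]
    linear_combination h + hg / 6

end LimitAtOne

section LambertSeries

variable {q ζ : ℂ}

lemma summable_twisted_prod {f : ℕ → ℂ} (hf : ∀ n, ‖f n‖ ≤ 1) (k : ℕ) (hq : ‖q‖ < 1) :
    Summable fun c : ℕ+ × ℕ+ => f c.1 * ((c.1 : ℂ) ^ k * q ^ (c.1 * c.2 : ℕ)) := by
  have h : Summable fun c : ℕ+ × ℕ+ => (c.1 : ℂ) ^ k * q ^ (c.2 * c.1 : ℕ) :=
    (summable_prod_mul_pow k hq).prod_symm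
  refine Summable.of_norm_bounded h.norm fun c => ?_
  rw [norm_mul, mul_comm (c.1 : ℕ)]
  exact mul_le_of_le_one_left (norm_nonneg _) (hf _)

/-- A Lambert series with bounded coefficients as a power series. -/
lemma tsum_lambert_eq_tsum_divisors {f : ℕ → ℂ} (hf : ∀ n, ‖f n‖ ≤ 1) (k : ℕ) (hq : ‖q‖ < 1) :
    ∑' n : ℕ+, f n * ((n : ℂ) ^ k * q ^ (n : ℕ) / (1 - q ^ (n : ℕ))) =
      ∑' n : ℕ, (∑ d ∈ n.divisors, f d * (d : ℂ) ^ k) * q ^ n := by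
  have hs := summable_twisted_prod hf k hq
  rw [← tsum_pnat_eq_tsum_of_eq_zero (by simp)]
  have h1 : ∑' c : ℕ+ × ℕ+, f c.1 * ((c.1 : ℂ) ^ k * q ^ (c.1 * c.2 : ℕ)) =
      ∑' n : ℕ+, f n * ((n : ℂ) ^ k * q ^ (n : ℕ) / (1 - q ^ (n : ℕ))) := by
    rw [hs.tsum_prod]
    refine tsum_congr fun n => ?_
    have hqn : ‖q ^ (n : ℕ)‖ < 1 := by
      rw [norm_pow]
      exact pow_lt_one₀ (norm_nonneg _) hq n.ne_zero
    have h2 := tsum_geometric_of_norm_lt_one hqn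
    rw [mul_div_assoc, div_eq_mul_inv, ← h2, ← tsum_mul_left, ← tsum_mul_left, ← tsum_mul_left,
      tsum_pnat_eq_tsum_succ (f := fun m => f n * ((n : ℂ) ^ k * q ^ ((n : ℕ) * m)))]
    refine tsum_congr fun m => ?_
    rw [pow_mul, pow_succ']
  have hs' : Summable fun x => f (sigmaAntidiagonalEquivProd x).1 *
      (((sigmaAntidiagonalEquivProd x).1 : ℂ) ^ k *
        q ^ ((sigmaAntidiagonalEquivProd x).1 * (sigmaAntidiagonalEquivProd x).2 : ℕ)) :=
    sigmaAntidiagonalEquivProd.summable_iff.2 hs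
  rw [← h1, ← sigmaAntidiagonalEquivProd.tsum_eq, hs'.tsum_sigma]
  refine tsum_congr fun n => ?_
  rw [tsum_fintype, Finset.univ_eq_attach]
  simp only [sigmaAntidiagonalEquivProd, divisorsAntidiagonalFactors, Equiv.coe_fn_mk,
    PNat.mk_coe]
  rw [(n : ℕ).divisorsAntidiagonal.sum_attach
      (fun x : ℕ × ℕ => f x.1 * ((x.1 : ℂ) ^ k * q ^ (x.1 * x.2))),
    Nat.sum_divisorsAntidiagonal (fun x y => f x * ((x : ℂ) ^ k * q ^ (x * y))), Finset.sum_mul]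
  refine Finset.sum_congr rfl fun d hd => ?_
  rw [Nat.mul_div_cancel' (Nat.dvd_of_mem_divisors hd), mul_assoc]

lemma norm_chi3_le_one (n : ℕ) : ‖(chi3 n : ℂ)‖ ≤ 1 := by
  unfold chi3
  split_ifs <;> simp

lemma cubeRoot_pow_sub (h3 : 1 + ζ + ζ ^ 2 = 0) (n : ℕ) :
    ζ ^ n - ζ⁻¹ ^ n = (2 * ζ + 1) * chi3 n := by
  have h := cubeRoot_pow_three h3
  rw [← cubeRoot_sq_eq_inv h3, ← pow_mul, ← Nat.div_add_mod n 3, mul_add, pow_add, pow_mul, h,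
    mul_left_comm, pow_add, pow_mul ζ 3, h, one_pow, one_pow, chi3, Nat.mul_add_mod, Nat.mod_mod]
  have : n % 3 < 3 := Nat.mod_lt _ (by norm_num)
  interval_cases n % 3
  · simp
  · simp
    linear_combination -h3
  · simp
    linear_combination h3 - ζ * h

lemma cubeRoot_pow_add (h3 : 1 + ζ + ζ ^ 2 = 0) (n : ℕ) :
    ζ ^ n + ζ⁻¹ ^ n = -1 + if 3 ∣ n then 3 else 0 := by
  have h := cubeRoot_pow_three h3
  simp only [Nat.dvd_iff_mod_eq_zero]
  rw [← cubeRoot_sq_eq_inv h3, ← pow_mul, ← Nat.div_add_mod n 3, mul_add,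
    pow_add, pow_mul, h, mul_left_comm, pow_add, pow_mul ζ 3, h, one_pow, one_pow,
    Nat.mul_add_mod, Nat.mod_mod]
  have : n % 3 < 3 := Nat.mod_lt _ (by norm_num)
  interval_cases n % 3
  · norm_num
  · simp
    linear_combination h3
  · simp
    linear_combination h3 + ζ * h

lemma bilateral_lambertTail_cubeRoot_of_even (hq0 : q ≠ 0) (hq : ‖q‖ < 1)
    (h3 : 1 + ζ + ζ ^ 2 = 0) {j : ℕ} (hj : Even j) :
    bilateral (lambertTail q) j ζ =
      (2 * ζ + 1) * ∑' n : ℕ, (∑ d ∈ n.divisors, (chi3 d : ℂ) * (d : ℂ) ^ j) * q ^ n := by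
  rw [bilateral_lambertTail_eq_tsum_pnat hq0 hq j (norm_cubeRoot h3),
    ← tsum_lambert_eq_tsum_divisors norm_chi3_le_one j hq, ← tsum_mul_left]
  refine tsum_congr fun n => ?_
  rw [hj.add_one.neg_one_pow, neg_one_mul, ← sub_eq_add_neg, cubeRoot_pow_sub h3, mul_assoc]

lemma tsum_lambert_of_three_dvd (q : ℂ) (j : ℕ) :
    ∑' n : ℕ+, (if 3 ∣ (n : ℕ) then 3 else 0 : ℂ) *
      ((n : ℂ) ^ j * q ^ (n : ℕ) / (1 - q ^ (n : ℕ))) =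
      3 ^ (j + 1) * ∑' n : ℕ+, 1 *
        ((n : ℂ) ^ j * (q ^ 3) ^ (n : ℕ) / (1 - (q ^ 3) ^ (n : ℕ))) := by
  have hi : Function.Injective fun n : ℕ+ => 3 * n := fun a b h => by simpa using h
  rw [← hi.tsum_eq, ← tsum_mul_left]
  · refine tsum_congr fun n => ?_
    simp only [PNat.mul_coe, PNat.val_ofNat, dvd_mul_right, if_true, pow_mul]
    push_cast
    rw [mul_pow]
    ring
  · intro n hn
    have h : 3 ∣ (n : ℕ) := by
      by_contra h
      exact hn (by simp [h])
    obtain ⟨k, hk⟩ := h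
    have hk0 : 0 < k := by have := n.pos; omega
    exact ⟨⟨k, hk0⟩, PNat.eq (by rw [hk]; rfl)⟩

lemma bilateral_lambertTail_cubeRoot_of_odd (hq0 : q ≠ 0) (hq : ‖q‖ < 1)
    (h3 : 1 + ζ + ζ ^ 2 = 0) {j : ℕ} (hj : Odd j) :
    bilateral (lambertTail q) j ζ =
      3 ^ (j + 1) * ∑' n : ℕ, (∑ d ∈ n.divisors, (d : ℂ) ^ j) * (q ^ 3) ^ n -
      ∑' n : ℕ, (∑ d ∈ n.divisors, (d : ℂ) ^ j) * q ^ n := by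
  have hq3 : ‖q ^ 3‖ < 1 := by
    rw [norm_pow]
    exact pow_lt_one₀ (norm_nonneg _) hq three_ne_zero
  have hone (q : ℂ) (hq : ‖q‖ < 1) := tsum_lambert_eq_tsum_divisors (f := fun _ => 1)
    (by simp) j hq
  simp only [one_mul] at hone
  have hs : Summable fun n : ℕ+ => (n : ℂ) ^ j * q ^ (n : ℕ) / (1 - q ^ (n : ℕ)) :=
    (summable_norm_pow_mul_geometric_div_one_sub j hq).comp_injective PNat.coe_injective
  have hs3 : Summable fun n : ℕ+ => (if 3 ∣ (n : ℕ) then 3 else 0 : ℂ) *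
      ((n : ℂ) ^ j * q ^ (n : ℕ) / (1 - q ^ (n : ℕ))) := by
    refine Summable.of_norm_bounded (hs.norm.mul_left 3) fun n => ?_
    rw [norm_mul]
    gcongr
    split_ifs <;> simp
  have h := tsum_lambert_of_three_dvd q j
  simp only [one_mul] at h
  rw [bilateral_lambertTail_eq_tsum_pnat hq0 hq j (norm_cubeRoot h3), ← hone _ hq3, ← hone _ hq,
    ← h, ← hs3.tsum_sub hs]
  refine tsum_congr fun n => ?_
  rw [hj.add_one.neg_one_pow, one_mul, cubeRoot_pow_add h3]
  ring

end LambertSeries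

section Eisenstein

variable {τ ζ : ℂ}

/-- The nome `exp (2 * π * i * τ)`. -/
def nome (τ : ℂ) : ℂ := Complex.exp (2 * Real.pi * Complex.I * τ)

lemma nome_ne_zero (τ : ℂ) : nome τ ≠ 0 := Complex.exp_ne_zero _

lemma norm_nome_lt_one (hτ : 0 < τ.im) : ‖nome τ‖ < 1 := by
  rw [nome, Complex.norm_exp, Real.exp_lt_one_iff]
  simp
  positivity

lemma nome_three_mul (τ : ℂ) : nome (3 * τ) = nome τ ^ 3 := by
  rw [nome, nome, ← Complex.exp_nat_mul]
  congr 1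
  push_cast
  ring

lemma exists_cubeRoot : ∃ ζ : ℂ, 1 + ζ + ζ ^ 2 = 0 := by
  have h := (Complex.isPrimitiveRoot_exp 3 three_ne_zero).geom_sum_eq_zero (by norm_num)
  exact ⟨_, by simpa [Finset.sum_range_succ] using h⟩

lemma two_mul_lambertFun_zero_add_one (hτ : 0 < τ.im) (h3 : 1 + ζ + ζ ^ 2 = 0) :
    2 * lambertFun (nome τ) 0 ζ + 1 = (2 * ζ + 1) / 3 * E1 τ := by
  rw [lambertFun, geomRat_zero_cubeRoot h3, E1, ← nome,
    bilateral_lambertTail_cubeRoot_of_even (nome_ne_zero τ) (norm_nome_lt_one hτ) h3 Even.zero]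
  simp only [pow_zero, mul_one]
  ring

lemma lambertFun_two_cubeRoot (hτ : 0 < τ.im) (h3 : 1 + ζ + ζ ^ 2 = 0) :
    lambertFun (nome τ) 2 ζ = -(2 * ζ + 1) / 9 * E3 τ := by
  rw [lambertFun, geomRat_two_cubeRoot h3, E3, ← nome,
    bilateral_lambertTail_cubeRoot_of_even (nome_ne_zero τ) (norm_nome_lt_one hτ) h3 even_two]
  ring

lemma lambertFun_three_cubeRoot_eq_E4 (hτ : 0 < τ.im) (h3 : 1 + ζ + ζ ^ 2 = 0) :
    240 * lambertFun (nome τ) 3 ζ = 81 * E4 (3 * τ) - E4 τ := by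
  rw [lambertFun, geomRat_three_cubeRoot h3, E4, E4, ← nome, ← nome, nome_three_mul,
    bilateral_lambertTail_cubeRoot_of_odd (nome_ne_zero τ) (norm_nome_lt_one hτ) h3
      (by decide : Odd 3)]
  ring

lemma E4_eq (hτ : 0 < τ.im) :
    E4 τ = 1 + 120 * bilateral (lambertTail (nome τ)) 3 1 := by
  rw [E4, ← nome, bilateral_lambertTail_one_of_odd (nome_ne_zero τ) (norm_nome_lt_one hτ)
    (by decide : Odd 3), ← tsum_pnat_eq_tsum_of_eq_zero (by simp)]
  simp only [ArithmeticFunction.sigma_apply]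
  push_cast
  ring

lemma E1_mul_E3 (hτ : 0 < τ.im) : 80 * (E1 τ * E3 τ) = 81 * E4 (3 * τ) - E4 τ := by
  obtain ⟨ζ, h3⟩ : ∃ ζ : ℂ, 1 + ζ + ζ ^ 2 = 0 := exists_cubeRoot
  have h := lambertFun_three_cubeRoot (nome_ne_zero τ) (norm_nome_lt_one hτ) h3
  rw [lambertFun_two_cubeRoot hτ h3, two_mul_lambertFun_zero_add_one hτ h3] at h
  rw [← lambertFun_three_cubeRoot_eq_E4 hτ h3]
  linear_combination -240 * h + 320 / 3 * E1 τ * E3 τ * h3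

lemma E1_pow_four (hτ : 0 < τ.im) : 10 * E1 τ ^ 4 = 9 * E4 (3 * τ) + E4 τ := by
  obtain ⟨ζ, h3⟩ : ∃ ζ : ℂ, 1 + ζ + ζ ^ 2 = 0 := exists_cubeRoot
  have hq0 := nome_ne_zero τ
  have hq := norm_nome_lt_one hτ
  have h0 := lambertFun_zero_one_cubeRoot hq0 hq h3
  have h1 := lambertFun_one_sq hq0 hq (norm_cubeRoot h3) (cubeRoot_sq_ne_one h3)
  have h2 := bilateral_lambertTail_one_sq hq0 hq
  have h4 := lambertFun_three_cubeRoot_eq_E4 hτ h3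
  have h5 := E4_eq hτ
  have h6 := two_mul_lambertFun_zero_add_one hτ h3
  rw [lambertConv_zero_zero_zero hq0 hq] at h0
  have h7 : lambertFun (nome τ) 1 ζ =
      bilateral (lambertTail (nome τ)) 1 1 - (1 + 3 * E1 τ ^ 2) / 12 := by
    have h8 : lambertFun (nome τ) 0 ζ = ((2 * ζ + 1) / 3 * E1 τ - 1) / 2 := by
      linear_combination h6 / 2
    rw [h8] at h0
    linear_combination -h0 / 3 + E1 τ ^ 2 / 3 * h3
  rw [h7] at h1
  linear_combination 160 * h1 + 160 * h2 + 1 / 9 * h4 + 8 / 9 * h5 - 2 * h5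

end Eisenstein

/-- The identity `9E₄(3τ) − E₄(τ) = 8E₁(τ)(2E₃(τ) − E₁(τ)³)` for `τ` in the upper
half-plane. -/
theorem statement16 (τ : ℂ) (hτ : 0 < τ.im) :
    9 * E4 (3 * τ) - E4 τ = 8 * E1 τ * (2 * E3 τ - E1 τ ^ 3) := by
  linear_combination (-1 / 5) * E1_mul_E3 hτ + (4 / 5) * E1_pow_four hτ
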